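/- Let P be a hereditary graph property. Then the closure P̄ consists exactly of those functions W ∈ W₀ such that t_ind(F,W) = 0 for every finite simple graph F not in P. -/

import Mathlib

open MeasureTheory Filter Topology
open scoped ENNReal

noncomputable section

/-- The unit interval `[0,1]` as a subset of `ℝ`. -/
def I01 : Set ℝ := Set.Icc 0 1

/-- `W₀`: symmetric measurable functions `[0,1]² → [0,1]`
(represented as functions `ℝ → ℝ → ℝ`, with the relevant values on `[0,1]²`). -/
def IsGraphon (W : ℝ → ℝ → ℝ) : Prop :=
  Measurable (Function.uncurry W) ∧ (∀ x y, W x y = W y x) ∧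
    ∀ x y, W x y ∈ Set.Icc (0 : ℝ) 1

/-- The `L¹` norm of a kernel on `[0,1]²`. -/
def l1Norm (W : ℝ → ℝ → ℝ) : ℝ :=
  ∫ x in I01, ∫ y in I01, |W x y|

/-- The cut norm of a kernel on `[0,1]²`. -/
def cutNorm (W : ℝ → ℝ → ℝ) : ℝ :=
  sSup { r : ℝ | ∃ S T : Set ℝ, MeasurableSet S ∧ MeasurableSet T ∧ S ⊆ I01 ∧ T ⊆ I01 ∧
    r = |∫ x in S, ∫ y in T, W x y| }

/-- An invertible measure preserving map of `[0,1]`. -/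
structure InvMP where
  toFun : ℝ → ℝ
  invFun : ℝ → ℝ
  maps : ∀ x ∈ I01, toFun x ∈ I01
  mapsInv : ∀ x ∈ I01, invFun x ∈ I01
  measurePreserving :
    MeasurePreserving toFun (volume.restrict I01) (volume.restrict I01)
  measurePreservingInv :
    MeasurePreserving invFun (volume.restrict I01) (volume.restrict I01)
  leftInv : ∀ x ∈ I01, invFun (toFun x) = x
  rightInv : ∀ x ∈ I01, toFun (invFun x) = x

/-- `δ_□`: the cut distance, infimum of the cut norm over invertible measure
preserving transformations of `[0,1]`. -/
def deltaCut (U W : ℝ → ℝ → ℝ) : ℝ :=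
  ⨅ φ : InvMP, cutNorm (fun x y => U x y - W (φ.toFun x) (φ.toFun y))

/-- `δ₁`: the `L¹` distance minimized over invertible measure preserving
transformations of `[0,1]`. -/
def delta1 (U W : ℝ → ℝ → ℝ) : ℝ :=
  ⨅ φ : InvMP, l1Norm (fun x y => U x y - W (φ.toFun x) (φ.toFun y))



/-- A graph property: for each `n`, a set of simple graphs on `Fin n`. -/
def GraphProp := ∀ n : ℕ, Set (SimpleGraph (Fin n))

/-- Invariance under isomorphism (isomorphic graphs necessarily have the same
number of vertices). -/
def IsGraphProperty (P : GraphProp) : Prop :=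
  ∀ (n : ℕ) (G H : SimpleGraph (Fin n)), Nonempty (G ≃g H) → (G ∈ P n ↔ H ∈ P n)

/-- The normalized edit distance between graphs on a common vertex set. -/
def graphD1 {n : ℕ} (G H : SimpleGraph (Fin n)) : ℝ :=
  (symmDiff G.edgeSet H.edgeSet).ncard / (n ^ 2 : ℝ)

/-- The edit distance from a graph to a graph property (∞ if the property
contains no graph on the same number of nodes). -/
def graphD1P {n : ℕ} (G : SimpleGraph (Fin n)) (P : GraphProp) : ℝ≥0∞ :=
  ⨅ (H : SimpleGraph (Fin n)) (_ : H ∈ P n), ENNReal.ofReal (graphD1 G H)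

open Classical in
/-- The step function `W_G` associated with a graph `G` on `{1,…,n}`:
its value on `((i−1)/n, i/n] × ((j−1)/n, j/n]` is `1` iff `ij ∈ E(G)`. -/
def graphonOf {n : ℕ} (G : SimpleGraph (Fin n)) : ℝ → ℝ → ℝ := fun x y =>
  if ∃ i j : Fin n, G.Adj i j ∧ x ∈ Set.Ioc (((i : ℕ) : ℝ) / n) ((((i : ℕ) : ℝ) + 1) / n)
      ∧ y ∈ Set.Ioc (((j : ℕ) : ℝ) / n) ((((j : ℕ) : ℝ) + 1) / n)
  then 1 else 0

/-- `H` is (isomorphic to) an induced subgraph of `G`. -/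
def IsInducedSubgraph {n k : ℕ} (G : SimpleGraph (Fin n)) (H : SimpleGraph (Fin k)) : Prop :=
  ∃ f : Fin k ↪ Fin n, ∀ i j, H.Adj i j ↔ G.Adj (f i) (f j)

/-- The subgraph of `G` induced on the vertex subset `S` has property `P`
(as a graph on `k = |S|` nodes). -/
def inducedMem {n : ℕ} (G : SimpleGraph (Fin n)) (S : Finset (Fin n)) (k : ℕ)
    (P : GraphProp) : Prop :=
  ∃ H : SimpleGraph (Fin k), H ∈ P k ∧
    ∃ f : Fin k ↪ Fin n, (∀ i, f i ∈ S) ∧ ∀ i j, H.Adj i j ↔ G.Adj (f i) (f j)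

/-- The number of `k`-element vertex subsets of `G` inducing a subgraph with property `P`. -/
def goodCount {n : ℕ} (G : SimpleGraph (Fin n)) (k : ℕ) (P : GraphProp) : ℕ :=
  {S : Finset (Fin n) | S.card = k ∧ inducedMem G S k P}.ncard

/-- Testability of a graph property (Definition 1.1 of the paper). -/
def GraphTestable (P : GraphProp) : Prop :=
  ∃ P' : GraphProp, IsGraphProperty P' ∧
    (∀ (n : ℕ) (G : SimpleGraph (Fin n)), G ∈ P n → ∀ k, 1 ≤ k → k ≤ n →
      2 * n.choose k ≤ 3 * goodCount G k P') ∧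
    (∀ ε : ℝ, 0 < ε → ∃ kε : ℕ, 1 ≤ kε ∧
      ∀ (n : ℕ) (G : SimpleGraph (Fin n)) (k : ℕ), kε ≤ k → k ≤ n →
        ENNReal.ofReal ε ≤ graphD1P G P →
        3 * goodCount G k P' ≤ n.choose k)

def cube (k : ℕ) : Set (Fin k → ℝ) := Set.univ.pi fun _ => I01

open Classical in
/-- The homomorphism density `t(F,W)`. -/
def homDensity {k : ℕ} (F : SimpleGraph (Fin k)) (W : ℝ → ℝ → ℝ) : ℝ :=
  ∫ x in cube k, ∏ i : Fin k, ∏ j : Fin k,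
    if i < j ∧ F.Adj i j then W (x i) (x j) else 1

open Classical in
/-- The induced density `t_ind(F,W)`. -/
def indDensity {k : ℕ} (F : SimpleGraph (Fin k)) (W : ℝ → ℝ → ℝ) : ℝ :=
  ∫ x in cube k, ∏ i : Fin k, ∏ j : Fin k,
    if i < j then (if F.Adj i j then W (x i) (x j) else 1 - W (x i) (x j)) else 1

/-- Isomorphism of functions in `W₀`: equality of all homomorphism densities. -/
def GraphonIso (U W : ℝ → ℝ → ℝ) : Prop :=
  ∀ (k : ℕ) (F : SimpleGraph (Fin k)), homDensity F U = homDensity F W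

open Classical in
/-- `P(G(k,W) ∈ R')`, the probability that the `W`-random graph on `k` nodes
has property `R'`. -/
def probIn (k : ℕ) (W : ℝ → ℝ → ℝ) (R' : GraphProp) : ℝ :=
  ∑ F : SimpleGraph (Fin k), if F ∈ R' k then indDensity F W else 0

/-- The `L¹` distance from `W` to a set `R` of kernels, with value `∞` for `R = ∅`. -/
def d1SetE (W : ℝ → ℝ → ℝ) (R : Set (ℝ → ℝ → ℝ)) : ℝ≥0∞ :=
  ⨅ (U : ℝ → ℝ → ℝ) (_ : U ∈ R), ENNReal.ofReal (l1Norm fun x y => W x y - U x y)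

/-- The cut-norm distance from `W` to a set `R` of kernels, with value `∞` for `R = ∅`. -/
def dCutSetE (W : ℝ → ℝ → ℝ) (R : Set (ℝ → ℝ → ℝ)) : ℝ≥0∞ :=
  ⨅ (U : ℝ → ℝ → ℝ) (_ : U ∈ R), ENNReal.ofReal (cutNorm fun x y => W x y - U x y)

/-- The open ball `B₁(R,c)` (within `W₀`). -/
def ball1 (R : Set (ℝ → ℝ → ℝ)) (c : ℝ) : Set (ℝ → ℝ → ℝ) :=
  {W | IsGraphon W ∧ d1SetE W R < ENNReal.ofReal c}

/-- The open ball `B_□(R,c)` (within `W₀`). -/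
def ballCut (R : Set (ℝ → ℝ → ℝ)) (c : ℝ) : Set (ℝ → ℝ → ℝ) :=
  {W | IsGraphon W ∧ dCutSetE W R < ENNReal.ofReal c}

/-- A graphon property: a set of graphons invariant under isomorphism. -/
def IsGraphonProperty (R : Set (ℝ → ℝ → ℝ)) : Prop :=
  (∀ W ∈ R, IsGraphon W) ∧
    ∀ U W, IsGraphon U → IsGraphon W → GraphonIso U W → (U ∈ R ↔ W ∈ R)

/-- A set of graphons is closed if it is closed in the cut norm. -/
def CutClosed (R : Set (ℝ → ℝ → ℝ)) : Prop :=
  ∀ W, IsGraphon W →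
    (∀ ε : ℝ, 0 < ε → ∃ U ∈ R, cutNorm (fun x y => W x y - U x y) < ε) → W ∈ R

/-- Testability of a graphon property. -/
def GraphonTestable (R : Set (ℝ → ℝ → ℝ)) : Prop :=
  ∃ R' : GraphProp, IsGraphProperty R' ∧
    (∀ W ∈ R, ∀ k : ℕ, 1 ≤ k → (2 : ℝ) / 3 ≤ probIn k W R') ∧
    (∀ ε : ℝ, 0 < ε → ∃ kε : ℕ, 1 ≤ kε ∧ ∀ k, kε ≤ k → ∀ W, IsGraphon W →
      ENNReal.ofReal ε ≤ d1SetE W R → probIn k W R' ≤ 1 / 3)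

/-- The closure `P̄` of a graph property: limits of convergent sequences
of graphs in `P` with sizes tending to infinity. -/
def closureP (P : GraphProp) : Set (ℝ → ℝ → ℝ) :=
  {W | IsGraphon W ∧ ∃ (n : ℕ → ℕ) (G : ∀ m, SimpleGraph (Fin (n m))),
    (∀ m, G m ∈ P (n m)) ∧ Tendsto n atTop atTop ∧
    Tendsto (fun m => deltaCut (graphonOf (G m)) W) atTop (nhds 0)}

/-- A graph property is robust if graphs whose `W_G` is `d₁`-close to `P̄`
are themselves close to `P` in edit distance. -/
def Robust (P : GraphProp) : Prop :=
  ∀ ε : ℝ, 0 < ε → ∃ (N : ℕ) (ε' : ℝ), 1 ≤ N ∧ 0 < ε' ∧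
    ∀ (n : ℕ), N ≤ n → ∀ G : SimpleGraph (Fin n),
      d1SetE (graphonOf G) (closureP P) ≤ ENNReal.ofReal ε' →
      graphD1P G P ≤ ENNReal.ofReal ε

/-- A hereditary graph property: closed under induced subgraphs. -/
def Hereditary (P : GraphProp) : Prop :=
  ∀ (n : ℕ) (G : SimpleGraph (Fin n)), G ∈ P n →
    ∀ (k : ℕ) (H : SimpleGraph (Fin k)), IsInducedSubgraph G H → H ∈ P k

/-- `U` is a flexing of `W`: `U ∈ W₀` agrees with `W` wherever `W` takes value `0` or `1`. -/
def Flexing (U W : ℝ → ℝ → ℝ) : Prop :=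
  IsGraphon U ∧ ∀ x y, (W x y = 0 ∨ W x y = 1) → U x y = W x y

/-- A function property is flexible if it is preserved under flexing. -/
def FlexibleFamily (R : Set (ℝ → ℝ → ℝ)) : Prop :=
  ∀ W ∈ R, ∀ U, Flexing U W → U ∈ R

/-- `U' ≤ W'` almost everywhere on `[0,1]²`. -/
def aeLE (U W : ℝ → ℝ → ℝ) : Prop :=
  ∀ᵐ p ∂(volume.restrict (I01 ×ˢ I01)), U p.1 p.2 ≤ W p.1 p.2

/-- `U ⪯ W`: up to isomorphism, `U ≤ W` almost everywhere. -/
def graphonLE (U W : ℝ → ℝ → ℝ) : Prop :=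
  ∃ U' W', IsGraphon U' ∧ IsGraphon W' ∧ GraphonIso U U' ∧ GraphonIso W W' ∧ aeLE U' W'

/-- The upward closure of a graph property: graphs having a spanning subgraph in `P`. -/
def upP (P : GraphProp) : GraphProp :=
  fun n => {G | ∃ H : SimpleGraph (Fin n), H ∈ P n ∧ H ≤ G}

/-- The upward closure of a function property. -/
def upR (R : Set (ℝ → ℝ → ℝ)) : Set (ℝ → ℝ → ℝ) :=
  {W | IsGraphon W ∧ ∃ U ∈ R, graphonLE U W}

/-- A stepfunction: constant on the products of a finite measurable partition of `[0,1]`. -/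
def IsStepfunction (W : ℝ → ℝ → ℝ) : Prop :=
  ∃ (m : ℕ) (S : Fin m → Set ℝ), (∀ i, MeasurableSet (S i)) ∧
    (⋃ i, S i) = I01 ∧ (∀ i j, i ≠ j → Disjoint (S i) (S j)) ∧
    ∀ i j : Fin m, ∀ x ∈ S i, ∀ x' ∈ S i, ∀ y ∈ S j, ∀ y' ∈ S j, W x y = W x' y'

open Classical in
/-- A testable graphon functional: its value can be estimated from `W`-random graphs. -/
def TestableFunctional (f : (ℝ → ℝ → ℝ) → ℝ) : Prop :=
  ∃ g : ∀ n : ℕ, SimpleGraph (Fin n) → ℝ,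
    (∀ (n : ℕ) (G H : SimpleGraph (Fin n)), Nonempty (G ≃g H) → g n G = g n H) ∧
    ∀ ε : ℝ, 0 < ε → ∃ kε : ℕ, 1 ≤ kε ∧ ∀ k, kε ≤ k → ∀ W, IsGraphon W →
      (∑ F : SimpleGraph (Fin k), if ε < |f W - g k F| then indDensity F W else 0) < 1 / 3


/-- Uniform measure on the unit interval. -/
def mu01 : Measure ℝ := volume.restrict I01

instance mu01_prob : IsProbabilityMeasure mu01 := by
  constructor
  simp [mu01, I01]

lemma restrict_cube (k : ℕ) :
    (volume : Measure (Fin k → ℝ)).restrict (cube k) = Measure.pi (fun _ => mu01) := by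
  rw [cube, volume_pi, Measure.restrict_pi_pi]; rfl

lemma mp_pair {ι : Type*} [Fintype ι] (μ : ι → Measure ℝ) [∀ i, IsProbabilityMeasure (μ i)]
    {a b : ι} (hab : a ≠ b) :
    MeasurePreserving (fun x : ι → ℝ => (x a, x b)) (Measure.pi μ) ((μ a).prod (μ b)) := by
  refine ⟨by fun_prop, ?_⟩
  have h := (ProbabilityTheory.iIndepFun_pi (μ := μ) (X := fun _ => id)
    (fun i => aemeasurable_id)).indepFun hab
  have h2 := (ProbabilityTheory.indepFun_iff_map_prod_eq_prod_map_map (measurable_pi_apply a).aemeasurable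
    (measurable_pi_apply b).aemeasurable).1 h
  have e1 := (measurePreserving_eval μ a).map_eq
  have e2 := (measurePreserving_eval μ b).map_eq
  refine h2.trans ?_
  exact congrArg₂ Measure.prod e1 e2

lemma mp_update {k : ℕ} (a : Fin k) :
    MeasurePreserving (fun p : (Fin k → ℝ) × ℝ => Function.update p.1 a p.2)
      ((Measure.pi fun _ => mu01).prod mu01) (Measure.pi fun _ => mu01) := by
  have hm : Measurable (fun p : (Fin k → ℝ) × ℝ => Function.update p.1 a p.2) := by
    refine measurable_pi_iff.2 fun i => ?_
    by_cases h : i = a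
    · subst h; simp only [Function.update_self]; fun_prop
    · simp only [Function.update_of_ne h]; fun_prop
  refine ⟨hm, ?_⟩
  symm
  refine Measure.pi_eq fun s hs => ?_
  rw [Measure.map_apply hm (MeasurableSet.univ_pi hs)]
  have : (fun p : (Fin k → ℝ) × ℝ => Function.update p.1 a p.2) ⁻¹' (Set.univ.pi s)
      = (Set.univ.pi (Function.update s a Set.univ)) ×ˢ (s a) := by
    ext ⟨x, t⟩
    simp only [Set.mem_preimage, Set.mem_pi, Set.mem_univ, true_imp_iff, Set.mem_prod]
    constructor
    · intro h
      refine ⟨fun i => ?_, by simpa using h a⟩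
      by_cases hi : i = a
      · subst hi; simp
      · simpa [hi] using h i
    · rintro ⟨h1, h2⟩ i
      by_cases hi : i = a
      · subst hi; simpa using h2
      · simpa [hi] using h1 i
  rw [this, Measure.prod_prod, Measure.pi_pi, ← Finset.prod_erase_mul _ _ (Finset.mem_univ a),
    ← Finset.prod_erase_mul _ _ (Finset.mem_univ a)]
  simp only [Function.update_self, measure_univ, mul_one]
  congr 1
  refine Finset.prod_congr rfl fun i hi => ?_
  rw [Function.update_of_ne (Finset.ne_of_mem_erase hi)]

lemma integrable_of_bdd {α : Type*} [MeasurableSpace α] {μ : Measure α} [IsFiniteMeasure μ]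
    {f : α → ℝ} (hf : Measurable f) (C : ℝ) (hb : ∀ x, |f x| ≤ C) : Integrable f μ :=
  Integrable.of_bound hf.aestronglyMeasurable C (Eventually.of_forall hb)

lemma one_sided {h f : ℝ → ℝ} (hh : Measurable h) (C : ℝ) (hb : ∀ x, |h x| ≤ C)
    (hf : Measurable f) (hf0 : ∀ x, 0 ≤ f x) (hf1 : ∀ x, f x ≤ 1) :
    ∃ S, MeasurableSet S ∧ S ⊆ I01 ∧ ∫ x, f x * h x ∂mu01 ≤ ∫ x in S, h x := by
  have hS : MeasurableSet {x | 0 < h x} := measurableSet_lt measurable_const hh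
  have hI : MeasurableSet I01 := measurableSet_Icc
  refine ⟨{x | 0 < h x} ∩ I01, hS.inter hI, Set.inter_subset_right, ?_⟩
  rw [← Measure.restrict_restrict hS, ← integral_indicator hS]
  have hC : 0 ≤ C := (abs_nonneg _).trans (hb 0)
  refine integral_mono (integrable_of_bdd (hf.mul hh) C fun x => ?_)
    (integrable_of_bdd (hh.indicator hS) C fun x => ?_) fun x => ?_
  · rw [abs_mul, abs_of_nonneg (hf0 x)]
    nlinarith [hb x, hf1 x, hf0 x, abs_nonneg (h x)]
  · by_cases hx : 0 < h x
    · simpa [Set.indicator, hx] using hb x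
    · simpa [Set.indicator, hx] using hC
  · by_cases hx : 0 < h x
    · simp only [Set.indicator, Set.mem_ofPred_eq, hx, if_true]
      nlinarith [hf1 x]
    · simp only [Set.indicator, Set.mem_ofPred_eq, hx, if_false]
      nlinarith [hf0 x]

lemma bilin_le {D : ℝ → ℝ → ℝ} (hD : Measurable (Function.uncurry D)) (hb : ∀ x y, |D x y| ≤ 1)
    {δ : ℝ} (hδ : ∀ S T : Set ℝ, MeasurableSet S → MeasurableSet T → S ⊆ I01 → T ⊆ I01 →
      ∫ x in S, ∫ y in T, D x y ≤ δ) {f g : ℝ → ℝ}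
    (hf : Measurable f) (hf0 : ∀ x, 0 ≤ f x) (hf1 : ∀ x, f x ≤ 1)
    (hg : Measurable g) (hg0 : ∀ x, 0 ≤ g x) (hg1 : ∀ x, g x ≤ 1) :
    ∫ s, ∫ t, D s t * f s * g t ∂mu01 ∂mu01 ≤ δ := by
  have hfin : ∀ S : Set ℝ, S ⊆ I01 → IsFiniteMeasure (volume.restrict S) := fun S hS => by
    refine ⟨?_⟩
    rw [Measure.restrict_apply_univ]
    exact (measure_mono hS).trans_lt (by simp [I01])
  have hDg : Measurable (fun p : ℝ × ℝ => D p.1 p.2 * g p.2) :=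
    hD.mul (hg.comp measurable_snd)
  have hDgb : ∀ x y, |D x y * g y| ≤ 1 := fun x y => by
    rw [abs_mul, abs_of_nonneg (hg0 y)]
    nlinarith [hb x y, hg0 y, hg1 y, abs_nonneg (D x y)]
  have hh : Measurable (fun s => ∫ t, D s t * g t ∂mu01) :=
    (hDg.stronglyMeasurable.integral_prod_right (ν := mu01)).measurable
  have hhb : ∀ s, |∫ t, D s t * g t ∂mu01| ≤ 1 := fun s => by
    have := norm_integral_le_of_norm_le_const (μ := mu01) (f := fun t => D s t * g t) (C := 1)
      (Eventually.of_forall fun t => hDgb s t)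
    simpa using this
  obtain ⟨S, hS, hSI, h1⟩ := one_sided hh 1 hhb hf hf0 hf1
  have e1 : ∫ s, ∫ t, D s t * f s * g t ∂mu01 ∂mu01
      = ∫ s, f s * ∫ t, D s t * g t ∂mu01 ∂mu01 := by
    refine integral_congr_ae (Eventually.of_forall fun s => ?_)
    simp only
    rw [← integral_const_mul]
    refine integral_congr_ae (Eventually.of_forall fun t => ?_)
    simp only; ring
  have := hfin S hSI
  have e2 : ∫ s in S, ∫ t, D s t * g t ∂mu01 = ∫ t, g t * (∫ s in S, D s t) ∂mu01 := by
    rw [integral_integral_swap]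
    · refine integral_congr_ae (Eventually.of_forall fun t => ?_)
      simp only
      rw [← integral_const_mul]
      refine integral_congr_ae (Eventually.of_forall fun t => ?_)
      simp only; ring
    · exact integrable_of_bdd hDg 1 fun p => hDgb p.1 p.2
  have hDs : Measurable (fun p : ℝ × ℝ => D p.2 p.1) := hD.comp measurable_swap
  have hm2 : Measurable (fun t => ∫ s in S, D s t) :=
    (hDs.stronglyMeasurable.integral_prod_right (ν := volume.restrict S)).measurable
  have hb2 : ∀ t, |∫ s in S, D s t| ≤ (volume.restrict S).real Set.univ := fun t => by
    have := norm_integral_le_of_norm_le_const (μ := volume.restrict S) (f := fun s => D s t)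
      (C := 1) (Eventually.of_forall fun s => hb s t)
    simpa using this
  obtain ⟨T, hT, hTI, h2⟩ := one_sided hm2 _ hb2 hg hg0 hg1
  have := hfin T hTI
  rw [e1]
  refine h1.trans ?_
  rw [e2]
  refine h2.trans ?_
  rw [integral_integral_swap]
  · exact hδ S T hS hT hSI hTI
  · exact integrable_of_bdd hDs 1 fun p => hb p.2 p.1

lemma single_edge_le {k : ℕ} {D : ℝ → ℝ → ℝ} (hD : Measurable (Function.uncurry D))
    (hb : ∀ x y, |D x y| ≤ 1)
    {δ : ℝ} (hδ : ∀ S T : Set ℝ, MeasurableSet S → MeasurableSet T → S ⊆ I01 → T ⊆ I01 →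
      ∫ x in S, ∫ y in T, D x y ≤ δ) {a b : Fin k} (hab : a ≠ b) {f g : (Fin k → ℝ) → ℝ}
    (hf : Measurable f) (hf0 : ∀ x, 0 ≤ f x) (hf1 : ∀ x, f x ≤ 1)
    (hg : Measurable g) (hg0 : ∀ x, 0 ≤ g x) (hg1 : ∀ x, g x ≤ 1)
    (hfb : ∀ x t, f (Function.update x b t) = f x)
    (hga : ∀ x t, g (Function.update x a t) = g x) :
    ∫ x, D (x a) (x b) * f x * g x ∂(Measure.pi fun _ => mu01) ≤ δ := by
  have hmain : Measurable (fun x : Fin k → ℝ => D (x a) (x b) * f x * g x) :=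
    ((hD.comp (f := fun x : Fin k → ℝ => (x a, x b)) (by fun_prop)).mul hf).mul hg
  have hmb : ∀ x : Fin k → ℝ, |D (x a) (x b) * f x * g x| ≤ 1 := fun x => by
    rw [abs_mul, abs_mul, abs_of_nonneg (hg0 x), abs_of_nonneg (hf0 x)]
    have := hb (x a) (x b)
    have h3 : |D (x a) (x b)| * f x ≤ 1 := by nlinarith [hf0 x, hf1 x, abs_nonneg (D (x a) (x b))]
    have h4 : 0 ≤ |D (x a) (x b)| * f x := mul_nonneg (abs_nonneg _) (hf0 x)
    nlinarith [hg0 x, hg1 x]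
  have hu : ∀ c : Fin k, ∀ H : (Fin k → ℝ) → ℝ, Measurable H → (∀ x, |H x| ≤ 1) →
      ∫ x, H x ∂(Measure.pi fun _ => mu01)
        = ∫ x, ∫ t, H (Function.update x c t) ∂mu01 ∂(Measure.pi fun _ => mu01) := by
    intro c H hH hHb
    conv_lhs => rw [← (mp_update c).map_eq]
    rw [integral_map (mp_update c).measurable.aemeasurable hH.aestronglyMeasurable]
    rw [integral_prod]
    exact integrable_of_bdd (hH.comp (mp_update c).measurable) 1 fun p => hHb _
  have hH2 : Measurable (fun x : Fin k → ℝ => ∫ t, D ((Function.update x b t) a)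
      ((Function.update x b t) b) * f (Function.update x b t) * g (Function.update x b t) ∂mu01) :=
    ((hmain.comp (mp_update b).measurable).stronglyMeasurable.integral_prod_right'
      (ν := mu01)).measurable
  have hH2b : ∀ x : Fin k → ℝ, |∫ t, D ((Function.update x b t) a)
      ((Function.update x b t) b) * f (Function.update x b t) * g (Function.update x b t) ∂mu01|
      ≤ 1 := by
    intro x
    have := norm_integral_le_of_norm_le_const (μ := mu01)
      (f := fun t => D ((Function.update x b t) a)
      ((Function.update x b t) b) * f (Function.update x b t) * g (Function.update x b t)) (C := 1)
      (Eventually.of_forall fun s => hmb _)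
    simpa using this
  rw [hu b _ hmain hmb, hu a _ hH2]
  · have key : ∀ x : Fin k → ℝ, ∫ s, ∫ t, D ((Function.update (Function.update x a s) b t) a)
      ((Function.update (Function.update x a s) b t) b)
        * f (Function.update (Function.update x a s) b t)
        * g (Function.update (Function.update x a s) b t) ∂mu01 ∂mu01 ≤ δ := by
      intro x
      have := bilin_le hD hb hδ (f := fun s => f (Function.update x a s))
        (g := fun t => g (Function.update x b t))
        (hf.comp (by fun_prop)) (fun _ => hf0 _) (fun _ => hf1 _)
        (hg.comp (by fun_prop)) (fun _ => hg0 _) (fun _ => hg1 _)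
      refine le_of_eq_of_le ?_ this
      congr 1; ext s; congr 1; ext t
      rw [hfb]
      rw [Function.update_self, Function.update_of_ne hab, Function.update_self]
      rw [Function.update_comm hab, hga]
    calc _ ≤ ∫ x : Fin k → ℝ, δ ∂(Measure.pi fun _ => mu01) := by
            refine integral_mono (integrable_of_bdd ((hH2.comp
              (mp_update a).measurable).stronglyMeasurable.integral_prod_right'
              (ν := mu01)).measurable 1 fun x => ?_) (integrable_const δ) key
            have := norm_integral_le_of_norm_le_const (μ := mu01) (C := 1)
              (f := fun s => ∫ t, D ((Function.update (Function.update x a s) b t) a)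
                ((Function.update (Function.update x a s) b t) b)
                * f (Function.update (Function.update x a s) b t)
                * g (Function.update (Function.update x a s) b t) ∂mu01)
              (Eventually.of_forall fun s => hH2b (Function.update x a s))
            simpa using this
         _ = δ := by simp
  · exact hH2b

open Classical in
/-- The factor of the induced density integrand belonging to a pair of vertices. -/
def factor {k : ℕ} (F : SimpleGraph (Fin k)) (U : ℝ → ℝ → ℝ) (p : Fin k × Fin k)
    (x : Fin k → ℝ) : ℝ :=
  if p.1 < p.2 then (if F.Adj p.1 p.2 then U (x p.1) (x p.2) else 1 - U (x p.1) (x p.2)) else 1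

lemma indDensity_eq {k : ℕ} (F : SimpleGraph (Fin k)) (U : ℝ → ℝ → ℝ) :
    indDensity F U = ∫ x, ∏ p, factor F U p x ∂(Measure.pi fun _ => mu01) := by
  rw [indDensity, restrict_cube]
  congr 1
  ext x
  rw [Fintype.prod_prod_type]
  rfl

lemma factor_measurable {k : ℕ} (F : SimpleGraph (Fin k)) {U : ℝ → ℝ → ℝ} (hU : IsGraphon U)
    (p : Fin k × Fin k) : Measurable (factor F U p) := by
  have h : Measurable (fun x : Fin k → ℝ => U (x p.1) (x p.2)) :=
    hU.1.comp (f := fun x : Fin k → ℝ => (x p.1, x p.2)) (by fun_prop)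
  unfold factor
  split_ifs
  · exact h
  · exact measurable_const.sub h
  · exact measurable_const

lemma factor_mem {k : ℕ} (F : SimpleGraph (Fin k)) {U : ℝ → ℝ → ℝ} (hU : IsGraphon U)
    (p : Fin k × Fin k) (x : Fin k → ℝ) : 0 ≤ factor F U p x ∧ factor F U p x ≤ 1 := by
  have h := hU.2.2 (x p.1) (x p.2)
  unfold factor
  split_ifs
  · exact h
  · constructor <;> linarith [h.1, h.2]
  · simp

lemma factor_update {k : ℕ} (F : SimpleGraph (Fin k)) (U : ℝ → ℝ → ℝ)
    (p : Fin k × Fin k) (x : Fin k → ℝ) (c : Fin k) (t : ℝ)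
    (h : p.1 < p.2 → p.1 ≠ c ∧ p.2 ≠ c) :
    factor F U p (Function.update x c t) = factor F U p x := by
  unfold factor
  by_cases hp : p.1 < p.2
  · simp only [hp, if_true, Function.update_of_ne (h hp).1, Function.update_of_ne (h hp).2]
  · simp only [hp, if_false]

lemma hybrid_step {k : ℕ} (F : SimpleGraph (Fin k)) {U W : ℝ → ℝ → ℝ} (hU : IsGraphon U)
    (hW : IsGraphon W) {δ : ℝ}
    (hδ : ∀ S T : Set ℝ, MeasurableSet S → MeasurableSet T → S ⊆ I01 → T ⊆ I01 →
      |∫ x in S, ∫ y in T, (U x y - W x y)| ≤ δ)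
    (e : Fin k × Fin k) (K : Fin k × Fin k → ℝ → ℝ → ℝ) (hK : ∀ p, IsGraphon (K p)) :
    |∫ x, (factor F U e x - factor F W e x) * ∏ p ∈ Finset.univ.erase e, factor F (K p) p x
      ∂(Measure.pi fun _ => mu01)| ≤ δ := by
  have hδ0 : 0 ≤ δ := (abs_nonneg _).trans (hδ ∅ ∅ .empty .empty (by simp) (by simp))
  by_cases he : e.1 < e.2
  swap
  · simp [factor, he, hδ0]
  have hDm : Measurable (Function.uncurry fun x y => U x y - W x y) := hU.1.sub hW.1
  have hDm' : Measurable (Function.uncurry fun x y => W x y - U x y) := hW.1.sub hU.1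
  have hDb : ∀ x y, |U x y - W x y| ≤ 1 := fun x y => by
    have h1 := hU.2.2 x y
    have h2 := hW.2.2 x y
    rw [abs_le]; constructor <;> linarith [h1.1, h1.2, h2.1, h2.2]
  have hDb' : ∀ x y, |W x y - U x y| ≤ 1 := fun x y => by rw [abs_sub_comm]; exact hDb x y
  have hδ1 : ∀ S T : Set ℝ, MeasurableSet S → MeasurableSet T → S ⊆ I01 → T ⊆ I01 →
      ∫ x in S, ∫ y in T, (U x y - W x y) ≤ δ := fun S T a b c d =>
    (le_abs_self _).trans (hδ S T a b c d)
  have hδ2 : ∀ S T : Set ℝ, MeasurableSet S → MeasurableSet T → S ⊆ I01 → T ⊆ I01 →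
      ∫ x in S, ∫ y in T, (W x y - U x y) ≤ δ := fun S T a b c d => by
    refine le_trans (le_of_eq ?_) ((neg_le_abs _).trans (hδ S T a b c d))
    rw [← integral_neg]
    congr 1; ext x
    rw [← integral_neg]
    congr 1; ext y
    ring
  set f : (Fin k → ℝ) → ℝ := fun x => ∏ p ∈ (Finset.univ.erase e).filter
    (fun p => ¬ (p.1 = e.2 ∨ p.2 = e.2)), factor F (K p) p x with hf
  set g : (Fin k → ℝ) → ℝ := fun x => ∏ p ∈ (Finset.univ.erase e).filter
    (fun p => (p.1 = e.2 ∨ p.2 = e.2)), factor F (K p) p x with hg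
  have hfg : ∀ x, ∏ p ∈ Finset.univ.erase e, factor F (K p) p x = f x * g x := fun x => by
    rw [hf, hg, mul_comm]
    exact (Finset.prod_filter_mul_prod_filter_not _ _ _).symm
  have hfm : Measurable f := Finset.measurable_prod _ fun p _ => factor_measurable F (hK p) p
  have hgm : Measurable g := Finset.measurable_prod _ fun p _ => factor_measurable F (hK p) p
  have hf0 : ∀ x, 0 ≤ f x := fun x => Finset.prod_nonneg fun p _ => (factor_mem F (hK p) p x).1
  have hg0 : ∀ x, 0 ≤ g x := fun x => Finset.prod_nonneg fun p _ => (factor_mem F (hK p) p x).1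
  have hf1 : ∀ x, f x ≤ 1 := fun x => Finset.prod_le_one
    (fun p _ => (factor_mem F (hK p) p x).1) fun p _ => (factor_mem F (hK p) p x).2
  have hg1 : ∀ x, g x ≤ 1 := fun x => Finset.prod_le_one
    (fun p _ => (factor_mem F (hK p) p x).1) fun p _ => (factor_mem F (hK p) p x).2
  have hfb : ∀ x t, f (Function.update x e.2 t) = f x := fun x t => by
    refine Finset.prod_congr rfl fun p hp => factor_update F _ p x _ t fun _ => ?_
    have := (Finset.mem_filter.1 hp).2
    push Not at this
    exact this
  have hga : ∀ x t, g (Function.update x e.1 t) = g x := fun x t => by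
    refine Finset.prod_congr rfl fun p hp => factor_update F _ p x _ t fun hlt => ?_
    obtain ⟨h1, h2⟩ := Finset.mem_filter.1 hp
    have h3 := Finset.ne_of_mem_erase h1
    rcases h2 with h2 | h2
    · constructor
      · intro h; rw [← h, ← h2] at he; exact lt_irrefl _ he
      · intro h; rw [h2, h] at hlt; exact lt_asymm hlt he
    · constructor
      · intro h; exact h3 (Prod.ext h h2)
      · intro h; rw [← h, ← h2] at he; exact lt_irrefl _ he
  have hne : e.1 ≠ e.2 := he.ne
  have A1 := single_edge_le hDm hDb hδ1 hne hfm hf0 hf1 hgm hg0 hg1 hfb hga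
  have A2 := single_edge_le hDm' hDb' hδ2 hne hfm hf0 hf1 hgm hg0 hg1 hfb hga
  have A3 : ∫ x, (W (x e.1) (x e.2) - U (x e.1) (x e.2)) * f x * g x ∂(Measure.pi fun _ => mu01)
    = - ∫ x, (U (x e.1) (x e.2) - W (x e.1) (x e.2)) * f x * g x ∂(Measure.pi fun _ => mu01) := by
    rw [← integral_neg]
    congr 1; ext x; ring
  have A4 : |∫ x, (U (x e.1) (x e.2) - W (x e.1) (x e.2)) * f x * g x
      ∂(Measure.pi fun _ => mu01)| ≤ δ := by
    rw [abs_le]; constructor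
    · linarith
    · exact A1
  simp_rw [hfg]
  by_cases hadj : F.Adj e.1 e.2
  · refine le_of_eq_of_le ?_ A4
    congr 2; ext x
    simp only [factor, he, hadj, if_true]; ring
  · refine le_of_eq_of_le ?_ A4
    rw [← abs_neg, ← integral_neg]
    congr 2; ext x
    simp only [factor, he, hadj, if_true, if_false]; ring

lemma counting {k : ℕ} (F : SimpleGraph (Fin k)) {U W : ℝ → ℝ → ℝ} (hU : IsGraphon U)
    (hW : IsGraphon W) {δ : ℝ}
    (hδ : ∀ S T : Set ℝ, MeasurableSet S → MeasurableSet T → S ⊆ I01 → T ⊆ I01 →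
      |∫ x in S, ∫ y in T, (U x y - W x y)| ≤ δ) :
    |indDensity F U - indDensity F W| ≤ (Fintype.card (Fin k × Fin k)) * δ := by
  classical
  let K : Finset (Fin k × Fin k) → Fin k × Fin k → ℝ → ℝ → ℝ := fun s p => if p ∈ s then U else W
  have hK : ∀ s p, IsGraphon (K s p) := fun s p => by
    by_cases h : p ∈ s
    · simpa [K, h] using hU
    · simpa [K, h] using hW
  have hint : ∀ s, Integrable (fun x => ∏ p, factor F (K s p) p x)
      (Measure.pi fun _ : Fin k => mu01) := fun s => by
    refine integrable_of_bdd (Finset.measurable_prod _ fun p _ => factor_measurable F (hK s p) p)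
      1 fun x => ?_
    rw [abs_of_nonneg (Finset.prod_nonneg fun p _ => (factor_mem F (hK s p) p x).1)]
    exact Finset.prod_le_one
      (fun p _ => (factor_mem F (hK s p) p x).1) fun p _ => (factor_mem F (hK s p) p x).2
  have main : ∀ s : Finset (Fin k × Fin k),
      |(∫ x, ∏ p, factor F (K s p) p x ∂(Measure.pi fun _ => mu01)) - indDensity F W|
        ≤ s.card * δ := by
    intro s
    induction s using Finset.induction_on with
    | empty => simp [indDensity_eq, K]
    | insert e s hes ih =>
      have h1 := hybrid_step F hU hW hδ e (K s) (hK s)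
      have h2 : ∫ x, (factor F U e x - factor F W e x)
          * ∏ p ∈ Finset.univ.erase e, factor F (K s p) p x ∂(Measure.pi fun _ => mu01)
          = (∫ x, ∏ p, factor F (K (insert e s) p) p x ∂(Measure.pi fun _ => mu01))
            - ∫ x, ∏ p, factor F (K s p) p x ∂(Measure.pi fun _ => mu01) := by
        rw [← integral_sub (hint _) (hint _)]
        congr 1; ext x
        rw [← Finset.mul_prod_erase _ _ (Finset.mem_univ e),
          ← Finset.mul_prod_erase _ _ (Finset.mem_univ e)]
        have h3 : ∏ p ∈ Finset.univ.erase e, factor F (K (insert e s) p) p x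
            = ∏ p ∈ Finset.univ.erase e, factor F (K s p) p x := by
          refine Finset.prod_congr rfl fun p hp => ?_
          have : p ≠ e := Finset.ne_of_mem_erase hp
          simp [K, this]
        rw [h3]
        simp only [K, hes, Finset.mem_insert_self, if_true, if_false]
        ring
      rw [h2] at h1
      rw [Finset.card_insert_of_notMem hes]
      push_cast
      have h4 := abs_add_le ((∫ x, ∏ p, factor F (K (insert e s) p) p x
        ∂(Measure.pi fun _ => mu01)) - ∫ x, ∏ p, factor F (K s p) p x ∂(Measure.pi fun _ => mu01))
        ((∫ x, ∏ p, factor F (K s p) p x ∂(Measure.pi fun _ => mu01)) - indDensity F W)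
      rw [sub_add_sub_cancel] at h4
      linarith
  have := main Finset.univ
  rw [indDensity_eq F U]
  simpa [K] using this

lemma isGraphon_comp {W : ℝ → ℝ → ℝ} (hW : IsGraphon W) (φ : InvMP) :
    IsGraphon (fun x y => W (φ.toFun x) (φ.toFun y)) := by
  have := φ.measurePreserving.measurable
  refine ⟨hW.1.comp (f := fun p : ℝ × ℝ => (φ.toFun p.1, φ.toFun p.2)) (by fun_prop),
    fun x y => hW.2.1 _ _, fun x y => hW.2.2 _ _⟩

lemma indDensity_comp {k : ℕ} (F : SimpleGraph (Fin k)) {W : ℝ → ℝ → ℝ} (hW : IsGraphon W)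
    (φ : InvMP) : indDensity F (fun x y => W (φ.toFun x) (φ.toFun y)) = indDensity F W := by
  have hmp := measurePreserving_pi (fun _ : Fin k => mu01) (fun _ : Fin k => mu01)
    (f := fun _ => φ.toFun) (fun _ => φ.measurePreserving)
  rw [indDensity_eq, indDensity_eq]
  conv_rhs => rw [← hmp.map_eq]
  rw [integral_map hmp.measurable.aemeasurable
    (Finset.measurable_prod _ fun p _ => factor_measurable F hW p).aestronglyMeasurable]
  rfl

lemma le_cutNorm {U W : ℝ → ℝ → ℝ} (hU : IsGraphon U) (hW : IsGraphon W) {S T : Set ℝ}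
    (hS : MeasurableSet S) (hT : MeasurableSet T) (hSI : S ⊆ I01) (hTI : T ⊆ I01) :
    |∫ x in S, ∫ y in T, (U x y - W x y)| ≤ cutNorm (fun x y => U x y - W x y) := by
  refine le_csSup ⟨1, ?_⟩ ⟨S, T, hS, hT, hSI, hTI, rfl⟩
  rintro r ⟨S, T, hS, hT, hSI, hTI, rfl⟩
  have hv : ∀ S : Set ℝ, S ⊆ I01 → volume S < ∞ ∧ volume.real S ≤ 1 := fun S hS => by
    have h1 : volume I01 = 1 := by simp [I01]
    have h2 : volume S ≤ 1 := h1 ▸ measure_mono hS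
    refine ⟨h2.trans_lt ENNReal.one_lt_top, ?_⟩
    exact ENNReal.toReal_le_of_le_ofReal zero_le_one (by simpa using h2)
  have hDb : ∀ x y, ‖U x y - W x y‖ ≤ 1 := fun x y => by
    have h1 := hU.2.2 x y
    have h2 := hW.2.2 x y
    rw [Real.norm_eq_abs, abs_le]; constructor <;> linarith [h1.1, h1.2, h2.1, h2.2]
  have h1 : ∀ x, ‖∫ y in T, (U x y - W x y)‖ ≤ 1 := fun x => by
    refine (norm_setIntegral_le_of_norm_le_const (hv T hTI).1 fun y _ => hDb x y).trans ?_
    simpa using (hv T hTI).2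
  refine (norm_setIntegral_le_of_norm_le_const (hv S hSI).1 fun y _ => h1 y).trans ?_
  simpa using (hv S hSI).2

/-- The `i`-th cell of the equipartition of `(0,1]` into `n` intervals. -/
def cell {n : ℕ} (i : Fin n) : Set ℝ := Set.Ioc (((i : ℕ) : ℝ) / n) ((((i : ℕ) : ℝ) + 1) / n)

lemma cell_le {n : ℕ} {i j : Fin n} {x : ℝ} (hi : x ∈ cell i) (hj : x ∈ cell j) : i ≤ j := by
  have hn : (0 : ℝ) < n := by exact_mod_cast i.pos
  have h1 : ((i : ℕ) : ℝ) / n < (((j : ℕ) : ℝ) + 1) / n := hi.1.trans_le hj.2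
  rw [div_lt_div_iff_of_pos_right hn] at h1
  have : (i : ℕ) < j + 1 := by exact_mod_cast h1
  exact Fin.le_def.2 (by omega)

lemma cell_inj {n : ℕ} {i j : Fin n} {x : ℝ} (hi : x ∈ cell i) (hj : x ∈ cell j) : i = j :=
  le_antisymm (cell_le hi hj) (cell_le hj hi)

lemma cell_cover {n : ℕ} (hn : 0 < n) {x : ℝ} (h0 : 0 < x) (h1 : x ≤ 1) :
    ∃ i : Fin n, x ∈ cell i := by
  have hn' : (0 : ℝ) < n := by exact_mod_cast hn
  have hpos : 0 < ⌈(n : ℝ) * x⌉₊ := Nat.ceil_pos.2 (by positivity)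
  have hle : ⌈(n : ℝ) * x⌉₊ ≤ n := Nat.ceil_le.2 (by nlinarith)
  obtain ⟨m, hm⟩ := Nat.exists_eq_succ_of_ne_zero hpos.ne'
  refine ⟨⟨m, by omega⟩, ?_, ?_⟩
  · rw [div_lt_iff₀ hn']
    have : m < ⌈(n : ℝ) * x⌉₊ := by omega
    have := Nat.lt_ceil.1 this
    simpa [mul_comm] using this
  · rw [le_div_iff₀ hn']
    have := Nat.le_ceil ((n : ℝ) * x)
    rw [hm] at this
    push_cast at this
    simpa [mul_comm] using this

lemma cell_dist {n : ℕ} {i : Fin n} {x y : ℝ} (hx : x ∈ cell i) (hy : y ∈ cell i) :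
    |x - y| ≤ 1 / n := by
  have h1 := hx.1
  have h2 := hx.2
  have h3 := hy.1
  have h4 := hy.2
  rw [add_div] at h2 h4
  rw [abs_le]; constructor <;> linarith

lemma cell_subset {n : ℕ} (i : Fin n) : cell i ⊆ I01 := by
  have hn : (0 : ℝ) < n := by exact_mod_cast i.pos
  intro x hx
  refine ⟨le_trans (by positivity) hx.1.le, hx.2.trans ?_⟩
  rw [div_le_one hn]
  exact_mod_cast i.2

lemma cell_meas {n : ℕ} (i : Fin n) : MeasurableSet (cell i) := measurableSet_Ioc

lemma cell_volume {n : ℕ} (i : Fin n) : volume (cell i) = ENNReal.ofReal (1 / n) := by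
  rw [cell, Real.volume_Ioc]; congr 1; ring

open Classical in
lemma graphonOf_apply {n : ℕ} (G : SimpleGraph (Fin n)) {i j : Fin n} {x y : ℝ}
    (hx : x ∈ cell i) (hy : y ∈ cell j) :
    graphonOf G x y = if G.Adj i j then 1 else 0 := by
  unfold graphonOf
  refine if_congr ⟨?_, fun h => ⟨i, j, h, hx, hy⟩⟩ rfl rfl
  rintro ⟨i', j', h, hx', hy'⟩
  rwa [cell_inj hx hx', cell_inj hy hy']

open Classical in
lemma graphonOf_isGraphon {n : ℕ} (G : SimpleGraph (Fin n)) : IsGraphon (graphonOf G) := by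
  refine ⟨?_, fun x y => ?_, fun x y => ?_⟩
  · have : Function.uncurry (graphonOf G) = Set.indicator
      (⋃ i : Fin n, ⋃ j : Fin n, ⋃ _ : G.Adj i j, cell i ×ˢ cell j) 1 := by
      ext ⟨x, y⟩
      simp only [Function.uncurry, graphonOf, Set.indicator, Pi.one_apply]
      refine if_congr ?_ rfl rfl
      simp only [Set.mem_iUnion, Set.mem_prod, exists_prop]
      rfl
    rw [this]
    refine measurable_one.indicator ?_
    exact MeasurableSet.iUnion fun i => MeasurableSet.iUnion fun j => MeasurableSet.iUnion fun _ =>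
      (cell_meas i).prod (cell_meas j)
  · unfold graphonOf
    refine if_congr ⟨?_, ?_⟩ rfl rfl <;>
    · rintro ⟨i, j, h, hx, hy⟩
      exact ⟨j, i, h.symm, hy, hx⟩
  · unfold graphonOf
    split_ifs <;> simp

/-- Indicator that two coordinates are within `1/n`. -/
def nearInd {k : ℕ} (n : ℕ) (p : Fin k × Fin k) (x : Fin k → ℝ) : ℝ :=
  Set.indicator {q : ℝ × ℝ | |q.1 - q.2| ≤ 1 / n} 1 (x p.1, x p.2)

lemma near_meas (n : ℕ) : MeasurableSet {q : ℝ × ℝ | |q.1 - q.2| ≤ 1 / (n : ℝ)} :=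
  measurableSet_le (by fun_prop) measurable_const

lemma nearInd_integral {k : ℕ} (n : ℕ) (p : Fin k × Fin k) (hp : p.1 ≠ p.2) :
    ∫ x, nearInd n p x ∂(Measure.pi fun _ => mu01) ≤ 2 / n := by
  have hmp := mp_pair (fun _ : Fin k => mu01) hp
  have hm : Measurable (Set.indicator {q : ℝ × ℝ | |q.1 - q.2| ≤ 1 / (n : ℝ)} (1 : ℝ × ℝ → ℝ)) :=
    measurable_one.indicator (near_meas n)
  have e1 := integral_map (μ := Measure.pi fun _ : Fin k => mu01) hmp.measurable.aemeasurable
    (f := Set.indicator {q : ℝ × ℝ | |q.1 - q.2| ≤ 1 / (n : ℝ)} (1 : ℝ × ℝ → ℝ))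
    hm.aestronglyMeasurable
  rw [hmp.map_eq] at e1
  unfold nearInd
  rw [← e1, integral_indicator_one (near_meas n), measureReal_def]
  refine ENNReal.toReal_le_of_le_ofReal (by positivity) ?_
  rw [Measure.prod_apply (near_meas n)]
  calc _ ≤ ∫⁻ s, ENNReal.ofReal (2 / n) ∂mu01 := by
        refine lintegral_mono fun s => ?_
        have h1 : Prod.mk s ⁻¹' {q : ℝ × ℝ | |q.1 - q.2| ≤ 1 / (n : ℝ)}
            = Set.Icc (s - 1 / n) (s + 1 / n) := by
          ext t
          simp only [Set.mem_preimage, Set.mem_ofPred_eq, Set.mem_Icc, abs_le]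
          constructor <;> rintro ⟨h1, h2⟩ <;> constructor <;> linarith
        simp only [h1]
        refine (Measure.restrict_apply_le _ _).trans ?_
        rw [Real.volume_Icc]
        refine ENNReal.ofReal_le_ofReal (le_of_eq ?_)
        ring
    _ = _ := by simp

lemma ae_Ioc {k : ℕ} : ∀ᵐ x ∂(Measure.pi fun _ : Fin k => mu01), ∀ i, 0 < x i ∧ x i ≤ 1 := by
  rw [ae_all_iff]
  intro i
  have h : ∀ᵐ t ∂mu01, 0 < t ∧ t ≤ 1 := by
    have h1 : ∀ᵐ t ∂mu01, t ∈ I01 := ae_restrict_mem measurableSet_Icc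
    have h2 : ∀ᵐ t ∂mu01, t ≠ 0 := ae_restrict_of_ae (Measure.ae_ne volume 0)
    filter_upwards [h1, h2] with t h1 h2
    exact ⟨lt_of_le_of_ne h1.1 (Ne.symm h2), h1.2⟩
  exact (measurePreserving_eval (fun _ : Fin k => mu01) i).quasiMeasurePreserving.ae h

lemma indDensity_graph_le {n k : ℕ} (hn : 0 < n) (G : SimpleGraph (Fin n))
    (F : SimpleGraph (Fin k)) (hF : ¬ IsInducedSubgraph G F) :
    indDensity F (graphonOf G) ≤ (Fintype.card (Fin k × Fin k)) * (2 / n) := by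
  classical
  have hG := graphonOf_isGraphon G
  have hnn : ∀ (p : Fin k × Fin k) x, 0 ≤ nearInd n p x := fun p x =>
    Set.indicator_nonneg (fun _ _ => zero_le_one) _
  have hnm : ∀ (p : Fin k × Fin k), Measurable (nearInd n p) := fun p =>
    (measurable_one.indicator (near_meas n)).comp (f := fun x : Fin k → ℝ => (x p.1, x p.2))
      (by fun_prop)
  have hni : ∀ (p : Fin k × Fin k), Integrable (nearInd n p) (Measure.pi fun _ => mu01) :=
    fun p => integrable_of_bdd (hnm p) 1 fun x => by
      rw [abs_of_nonneg (hnn p x)]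
      exact Set.indicator_le_self' (fun _ _ => zero_le_one) _
  have hf0 : ∀ x, 0 ≤ ∏ p, factor F (graphonOf G) p x :=
    fun x => Finset.prod_nonneg fun p _ => (factor_mem F hG p x).1
  have hf1 : ∀ x, ∏ p, factor F (graphonOf G) p x ≤ 1 := fun x => Finset.prod_le_one
      (fun p _ => (factor_mem F hG p x).1) fun p _ => (factor_mem F hG p x).2
  rw [indDensity_eq]
  calc _ ≤ ∫ x, ∑ p ∈ Finset.univ.filter (fun p : Fin k × Fin k => p.1 ≠ p.2), nearInd n p x
          ∂(Measure.pi fun _ => mu01) := by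
        refine integral_mono_ae ?_ (integrable_finsetSum _ fun p _ => hni p) ?_
        · refine integrable_of_bdd (Finset.measurable_prod _ fun p _ => factor_measurable F hG p)
            1 fun x => ?_
          rw [abs_of_nonneg (hf0 x)]
          exact hf1 x
        filter_upwards [ae_Ioc] with x hx
        by_cases hbad : ∃ p : Fin k × Fin k, p.1 ≠ p.2 ∧ |x p.1 - x p.2| ≤ 1 / n
        · obtain ⟨p, hp, hd⟩ := hbad
          refine (hf1 x).trans ?_
          have h1 : nearInd n p x = 1 := by
            unfold nearInd
            rw [Set.indicator_of_mem]
            · rfl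
            · exact hd
          rw [← h1]
          exact Finset.single_le_sum (f := fun p => nearInd n p x) (fun p _ => hnn p x)
            (Finset.mem_filter.2 ⟨Finset.mem_univ p, hp⟩)
        · push Not at hbad
          refine le_trans (le_of_eq ?_) (Finset.sum_nonneg fun p _ => hnn p x)
          choose c hc using fun i => cell_cover hn (hx i).1 (hx i).2
          have hinj : Function.Injective c := by
            intro i j hij
            by_contra hne
            have h1 := hc j
            rw [← hij] at h1
            exact absurd (cell_dist (hc i) h1) (not_le.2 (hbad (i, j) hne))
          have hlt : ∃ i j, i < j ∧ ¬ (F.Adj i j ↔ G.Adj (c i) (c j)) := by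
            by_contra hcon
            push Not at hcon
            refine hF ⟨⟨c, hinj⟩, fun i j => ?_⟩
            rcases lt_trichotomy i j with h | h | h
            · exact hcon i j h
            · subst h; simp
            · rw [F.adj_comm, G.adj_comm]; exact hcon j i h
          obtain ⟨i, j, hij, hne⟩ := hlt
          refine Finset.prod_eq_zero (Finset.mem_univ (i, j)) ?_
          simp only [factor, hij, if_true]
          rw [graphonOf_apply G (hc i) (hc j)]
          by_cases h1 : F.Adj i j <;> by_cases h2 : G.Adj (c i) (c j) <;> simp_all
    _ = ∑ p ∈ Finset.univ.filter (fun p : Fin k × Fin k => p.1 ≠ p.2),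
          ∫ x, nearInd n p x ∂(Measure.pi fun _ => mu01) := integral_finsetSum _ fun p _ => hni p
    _ ≤ ∑ p ∈ Finset.univ.filter (fun p : Fin k × Fin k => p.1 ≠ p.2), (2 / n : ℝ) :=
        Finset.sum_le_sum fun p hp => nearInd_integral n p (Finset.mem_filter.1 hp).2
    _ ≤ _ := by
        rw [Finset.sum_const, nsmul_eq_mul]
        refine mul_le_mul_of_nonneg_right ?_ (by positivity)
        exact_mod_cast Finset.card_le_univ _

/-- The identity as an invertible measure preserving map. -/
def idMP : InvMP := ⟨id, id, fun _ h => h, fun _ h => h, .id _, .id _, fun _ _ => rfl,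
  fun _ _ => rfl⟩

lemma dir1 (P : GraphProp) (hher : Hereditary P) (W : ℝ → ℝ → ℝ) (hW : W ∈ closureP P)
    (k : ℕ) (F : SimpleGraph (Fin k)) (hF : F ∉ P k) : indDensity F W = 0 := by
  obtain ⟨hWg, n, G, hG, hn, hlim⟩ := hW
  set N : ℝ := ((Fintype.card (Fin k × Fin k) : ℕ) : ℝ) with hN
  have hN0 : 0 ≤ N := by positivity
  have h0 : 0 ≤ indDensity F W := by
    rw [indDensity_eq]
    exact integral_nonneg fun x => Finset.prod_nonneg fun p _ => (factor_mem F hWg p x).1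
  refine le_antisymm (le_of_forall_pos_le_add fun ε hε => ?_) h0
  have hε' : 0 < ε / (3 * (N + 1)) := by positivity
  have ev1 := hlim.eventually (gt_mem_nhds hε')
  obtain ⟨M, hM⟩ := exists_nat_gt (3 * (N + 1) / ε)
  have ev2 := hn.eventually (eventually_ge_atTop (M + 1))
  obtain ⟨m, h1, h2⟩ := (ev1.and ev2).exists
  have : Nonempty InvMP := ⟨idMP⟩
  obtain ⟨φ, hφ⟩ := exists_lt_of_ciInf_lt h1
  have hWφ := isGraphon_comp hWg φ
  have hGg := graphonOf_isGraphon (G m)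
  have hc := counting F hGg hWφ (fun S T a b c d => le_cutNorm hGg hWφ a b c d)
  rw [indDensity_comp F hWg] at hc
  have hni : ¬ IsInducedSubgraph (G m) F := fun h => hF (hher _ _ (hG m) k F h)
  have hg := indDensity_graph_le (by omega) (G m) F hni
  rw [← hN] at hc hg
  have hnm : (M : ℝ) < n m := by exact_mod_cast (by omega : M < n m)
  have hb1 : N * cutNorm (fun x y => graphonOf (G m) x y - W (φ.toFun x) (φ.toFun y))
      ≤ ε / 3 := by
    refine (mul_le_mul_of_nonneg_left hφ.le hN0).trans ?_
    rw [mul_div_assoc', div_le_div_iff₀ (by positivity) (by positivity)]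
    nlinarith
  have hb2 : N * (2 / n m) ≤ 2 * ε / 3 := by
    have hpos : (0 : ℝ) < n m := lt_of_le_of_lt (by positivity) hnm
    have h3 : 3 * (N + 1) < n m * ε := by
      have := hM.trans hnm
      rwa [div_lt_iff₀ hε] at this
    rw [mul_div_assoc', div_le_div_iff₀ hpos (by positivity)]
    nlinarith
  have := (abs_le.1 hc).1
  linarith

/-- Bernoulli weight. -/
def bw (q : ℝ) (b : Bool) : ℝ := if b then q else 1 - q

/-- A Boolean as a real number. -/
def br (b : Bool) : ℝ := if b then 1 else 0

/-- The centred adjacency matrix. -/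
def cmat {n : ℕ} (p : Sym2 (Fin n) → ℝ) (v : Sym2 (Fin n) → Bool) (i j : Fin n) : ℝ :=
  if i = j then 0 else br (v s(i, j)) - p s(i, j)

lemma sum_weight {ι : Type*} [Fintype ι] [DecidableEq ι] (p : ι → ℝ) :
    ∑ v : ι → Bool, ∏ e, bw (p e) (v e) = 1 := by
  have := Finset.prod_univ_sum (fun _ : ι => (Finset.univ : Finset Bool)) (fun e b => bw (p e) b)
  rw [Fintype.piFinset_univ] at this
  rw [← this]
  simp [bw]

lemma expect_zero {ι : Type*} [Fintype ι] [DecidableEq ι] (p : ι → ℝ) (e : ι)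
    (h : (ι → Bool) → ℝ) (hh : ∀ v b, h (Function.update v e b) = h v) :
    ∑ v : ι → Bool, (∏ e, bw (p e) (v e)) * ((br (v e) - p e) * h v) = 0 := by
  refine Finset.sum_involution (fun v _ => Function.update v e (!(v e))) ?_ ?_ ?_ ?_
  · intro v _
    rw [← Finset.mul_prod_erase _ _ (Finset.mem_univ e),
      ← Finset.mul_prod_erase _ _ (Finset.mem_univ e), hh]
    have : ∏ x ∈ Finset.univ.erase e, bw (p x) (Function.update v e (!(v e)) x)
        = ∏ x ∈ Finset.univ.erase e, bw (p x) (v x) :=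
      Finset.prod_congr rfl fun x hx => by rw [Function.update_of_ne (Finset.ne_of_mem_erase hx)]
    rw [this, Function.update_self]
    cases v e <;> simp [bw, br] <;> ring
  · intro v _ _ heq
    have := congrFun heq e
    simp at this
  · intro v _; exact Finset.mem_univ _
  · intro v _; simp

lemma bw_nonneg {q : ℝ} (hq : 0 ≤ q ∧ q ≤ 1) (b : Bool) : 0 ≤ bw q b := by
  cases b <;> simp [bw, hq.1, hq.2]

lemma cmat_abs {n : ℕ} {p : Sym2 (Fin n) → ℝ} (hp : ∀ e, 0 ≤ p e ∧ p e ≤ 1)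
    (v : Sym2 (Fin n) → Bool) (i j : Fin n) : |cmat p v i j| ≤ 1 := by
  have := hp s(i, j)
  unfold cmat br
  split_ifs
  · simp
  · rw [abs_le]; constructor <;> linarith
  · rw [abs_le]; constructor <;> linarith

lemma four_expect {n : ℕ} {p : Sym2 (Fin n) → ℝ} (hp : ∀ e, 0 ≤ p e ∧ p e ≤ 1)
    (i i' j j' : Fin n) :
    ∑ v : Sym2 (Fin n) → Bool, (∏ e, bw (p e) (v e)) *
      (cmat p v i j * cmat p v i j' * (cmat p v i' j * cmat p v i' j'))
      ≤ (if j = j' then 1 else 0) + (if i = i' then 1 else 0) := by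
  by_cases hd : j = j' ∨ i = i'
  · calc _ ≤ ∑ v : Sym2 (Fin n) → Bool, (∏ e, bw (p e) (v e)) * 1 := by
          refine Finset.sum_le_sum fun v _ => mul_le_mul_of_nonneg_left ?_
            (Finset.prod_nonneg fun e _ => bw_nonneg (hp e) _)
          refine (le_abs_self _).trans ?_
          rw [abs_mul, abs_mul, abs_mul]
          have h := cmat_abs hp v
          exact mul_le_one₀ (mul_le_one₀ (h _ _) (abs_nonneg _) (h _ _)) (by positivity)
            (mul_le_one₀ (h _ _) (abs_nonneg _) (h _ _))
      _ = 1 := by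
          simp only [mul_one]
          exact sum_weight p
      _ ≤ _ := by
          rcases hd with h | h <;> simp only [h, if_true] <;> split_ifs <;> norm_num
  · push Not at hd
    obtain ⟨hj, hi⟩ := hd
    rw [if_neg hj, if_neg hi, add_zero]
    refine le_of_eq ?_
    by_cases h1 : i = j
    · simp [cmat, h1]
    by_cases h2 : i = j'
    · simp [cmat, h2]
    by_cases h3 : i' = j
    · simp [cmat, h3]
    by_cases h4 : i' = j'
    · simp [cmat, h4]
    have := expect_zero p s(i, j)
      (fun v => cmat p v i j' * (cmat p v i' j * cmat p v i' j')) ?_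
    · rw [← this]
      refine Finset.sum_congr rfl fun v _ => ?_
      have e1 : cmat p v i j = br (v s(i, j)) - p s(i, j) := if_neg h1
      rw [e1]; ring
    · intro v b
      have n1 : s(i, j') ≠ s(i, j) := by
        intro h; simp only [Sym2.eq_iff] at h; grind
      have n2 : s(i', j) ≠ s(i, j) := by
        intro h; simp only [Sym2.eq_iff] at h; grind
      have n3 : s(i', j') ≠ s(i, j) := by
        intro h; simp only [Sym2.eq_iff] at h; grind
      simp only [cmat, Function.update_of_ne n1, Function.update_of_ne n2,
        Function.update_of_ne n3]

/-- The `C₄`-energy of a matrix. -/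
def energy {n : ℕ} (A : Fin n → Fin n → ℝ) : ℝ := ∑ j, ∑ j', (∑ i, A i j * A i j') ^ 2

lemma energy_expect {n : ℕ} {p : Sym2 (Fin n) → ℝ} (hp : ∀ e, 0 ≤ p e ∧ p e ≤ 1) :
    ∑ v, (∏ e, bw (p e) (v e)) * energy (cmat p v) ≤ 2 * (n : ℝ) ^ 3 := by
  have e1 : ∑ v, (∏ e, bw (p e) (v e)) * energy (cmat p v)
      = ∑ j, ∑ j', ∑ i, ∑ i', ∑ v, (∏ e, bw (p e) (v e)) *
      (cmat p v i j * cmat p v i j' * (cmat p v i' j * cmat p v i' j')) := by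
    simp only [energy, sq, Finset.sum_mul_sum]
    simp only [Finset.mul_sum]
    rw [Finset.sum_comm]; refine Finset.sum_congr rfl fun j _ => ?_
    rw [Finset.sum_comm]; refine Finset.sum_congr rfl fun j' _ => ?_
    rw [Finset.sum_comm]; refine Finset.sum_congr rfl fun i _ => ?_
    rw [Finset.sum_comm]
  rw [e1]
  calc _ ≤ ∑ j : Fin n, ∑ j' : Fin n, ∑ i : Fin n, ∑ i' : Fin n,
        (((if j = j' then 1 else 0) + (if i = i' then 1 else 0) : ℝ)) :=
        Finset.sum_le_sum fun j _ => Finset.sum_le_sum fun j' _ => Finset.sum_le_sum fun i _ =>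
          Finset.sum_le_sum fun i' _ => four_expect hp i i' j j'
    _ = 2 * (n : ℝ) ^ 3 := by
        simp [Finset.sum_add_distrib]
        ring

lemma exists_rounding {n : ℕ} {p : Sym2 (Fin n) → ℝ} (hp : ∀ e, 0 ≤ p e ∧ p e ≤ 1) :
    ∃ v, (∀ e, 0 < bw (p e) (v e)) ∧ energy (cmat p v) ≤ 2 * (n : ℝ) ^ 3 := by
  by_contra hcon
  push Not at hcon
  have hw0 : ∀ v : Sym2 (Fin n) → Bool, 0 ≤ ∏ e, bw (p e) (v e) := fun v =>
    Finset.prod_nonneg fun e _ => bw_nonneg (hp e) _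
  have hz : ∀ v : Sym2 (Fin n) → Bool,
      0 ≤ (∏ e, bw (p e) (v e)) * (energy (cmat p v) - 2 * (n : ℝ) ^ 3) ∧
      ((∏ e, bw (p e) (v e)) * (energy (cmat p v) - 2 * (n : ℝ) ^ 3) = 0 →
        ∏ e, bw (p e) (v e) = 0) := fun v => by
    rcases (hw0 v).eq_or_lt with h | h
    · rw [← h]; simp
    · have hpos : ∀ e, 0 < bw (p e) (v e) := fun e =>
        lt_of_le_of_ne (bw_nonneg (hp e) _) fun h0 =>
          h.ne' (Finset.prod_eq_zero (Finset.mem_univ e) h0.symm)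
      have h2 := hcon v hpos
      have h3 := mul_pos h (sub_pos.2 h2)
      exact ⟨h3.le, fun h4 => absurd h4 h3.ne'⟩
  have hs : ∑ v : Sym2 (Fin n) → Bool,
      (∏ e, bw (p e) (v e)) * (energy (cmat p v) - 2 * (n : ℝ) ^ 3) ≤ 0 := by
    simp only [mul_sub, Finset.sum_sub_distrib]
    rw [← Finset.sum_mul, sum_weight, one_mul]
    linarith [energy_expect hp]
  have hs0 := (Finset.sum_eq_zero_iff_of_nonneg fun v _ => (hz v).1).1
    (le_antisymm hs (Finset.sum_nonneg fun v _ => (hz v).1))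
  have h1 := sum_weight p
  rw [Finset.sum_eq_zero fun v hv => (hz v).2 (hs0 v hv)] at h1
  exact zero_ne_one h1

lemma bilinear_energy {n : ℕ} (A : Fin n → Fin n → ℝ) (a b : Fin n → ℝ) (c : ℝ)
    (ha0 : ∀ i, 0 ≤ a i) (ha : ∀ i, a i ≤ c) (hb0 : ∀ i, 0 ≤ b i) (hb : ∀ i, b i ≤ c) :
    (∑ i, ∑ j, A i j * (a i * b j)) ^ 4 ≤ (n : ℝ) ^ 4 * c ^ 8 * energy A := by
  set y : Fin n → ℝ := fun i => ∑ j, b j * A i j with hy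
  have e1 : ∑ i, ∑ j, A i j * (a i * b j) = ∑ i, a i * y i := by
    refine Finset.sum_congr rfl fun i _ => ?_
    rw [hy, Finset.mul_sum]
    exact Finset.sum_congr rfl fun j _ => by ring
  have h1 : (∑ i, a i * y i) ^ 2 ≤ (n * c ^ 2) * ∑ i, y i ^ 2 := by
    refine (Finset.sum_mul_sq_le_sq_mul_sq _ _ _).trans ?_
    refine mul_le_mul_of_nonneg_right ?_ (Finset.sum_nonneg fun i _ => sq_nonneg _)
    calc ∑ i, a i ^ 2 ≤ ∑ i : Fin n, c ^ 2 :=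
          Finset.sum_le_sum fun i _ => pow_le_pow_left₀ (ha0 i) (ha i) 2
      _ = _ := by simp
  have e2 : ∑ i, y i ^ 2 = ∑ q : Fin n × Fin n, (b q.1 * b q.2) * (∑ i, A i q.1 * A i q.2) := by
    rw [Fintype.sum_prod_type]
    simp only [hy, sq, Finset.sum_mul_sum]
    simp only [Finset.mul_sum]
    rw [Finset.sum_comm]; refine Finset.sum_congr rfl fun j _ => ?_
    rw [Finset.sum_comm]; refine Finset.sum_congr rfl fun j' _ => ?_
    refine Finset.sum_congr rfl fun i _ => ?_
    ring
  have h2 : (∑ i, y i ^ 2) ^ 2 ≤ ((n : ℝ) ^ 2 * c ^ 4) * energy A := by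
    rw [e2]
    refine (Finset.sum_mul_sq_le_sq_mul_sq _ _ _).trans ?_
    have : energy A = ∑ q : Fin n × Fin n, (∑ i, A i q.1 * A i q.2) ^ 2 := by
      rw [Fintype.sum_prod_type]; rfl
    rw [this]
    refine mul_le_mul_of_nonneg_right ?_ (Finset.sum_nonneg fun i _ => sq_nonneg _)
    calc ∑ q : Fin n × Fin n, (b q.1 * b q.2) ^ 2 ≤ ∑ q : Fin n × Fin n, (c * c) ^ 2 :=
          Finset.sum_le_sum fun q _ => pow_le_pow_left₀ (mul_nonneg (hb0 _) (hb0 _))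
            (mul_le_mul (hb _) (hb _) (hb0 _) ((hb0 q.1).trans (hb _))) 2
      _ = _ := by simp; ring
  rw [e1]
  calc (∑ i, a i * y i) ^ 4 = ((∑ i, a i * y i) ^ 2) ^ 2 := by ring
    _ ≤ ((n * c ^ 2) * ∑ i, y i ^ 2) ^ 2 := pow_le_pow_left₀ (sq_nonneg _) h1 2
    _ = (n * c ^ 2) ^ 2 * (∑ i, y i ^ 2) ^ 2 := by ring
    _ ≤ (n * c ^ 2) ^ 2 * (((n : ℝ) ^ 2 * c ^ 4) * energy A) :=
        mul_le_mul_of_nonneg_left h2 (sq_nonneg _)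
    _ = _ := by ring

/-- Uniform probability measure on a cell. -/
def cmu {n : ℕ} (i : Fin n) : Measure ℝ := (n : ℝ≥0∞) • volume.restrict (cell i)

instance cmu_prob {n : ℕ} (i : Fin n) : IsProbabilityMeasure (cmu i) := by
  have hn : (0 : ℝ) < n := by exact_mod_cast i.pos
  constructor
  rw [cmu, Measure.smul_apply, Measure.restrict_apply_univ, cell_volume, smul_eq_mul,
    ← ENNReal.ofReal_natCast, ← ENNReal.ofReal_mul hn.le, mul_one_div_cancel hn.ne',
    ENNReal.ofReal_one]

lemma cmu_ac (n : ℕ) :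
    Measure.pi (fun i : Fin n => cmu i) ≪ Measure.pi (fun _ : Fin n => mu01) := by
  have h1 : Measure.pi (fun i : Fin n => cmu i)
      = ((n : ℝ≥0∞) ^ n) • Measure.pi (fun i : Fin n => volume.restrict (cell i)) := by
    refine Measure.pi_eq fun s hs => ?_
    rw [Measure.smul_apply, Measure.pi_pi]
    simp [cmu, Finset.prod_mul_distrib]
  rw [h1]
  refine Measure.smul_absolutelyContinuous.trans ?_
  rw [← Measure.restrict_pi_pi, ← restrict_cube]
  refine Measure.absolutelyContinuous_of_le (Measure.restrict_mono ?_ le_rfl)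
  exact Set.pi_mono fun i _ => cell_subset i

/-- The uniform measure on the unit square. -/
def sq01 : Measure (ℝ × ℝ) := mu01.prod mu01

instance sq01_prob : IsProbabilityMeasure sq01 := by unfold sq01; infer_instance

lemma sq01_eq : sq01 = (volume.prod volume).restrict (I01 ×ˢ I01) :=
  Measure.prod_restrict _ _

lemma cmu_prod {n : ℕ} (i j : Fin n) :
    (cmu i).prod (cmu j) = ((n : ℝ≥0∞) * n) • sq01.restrict (cell i ×ˢ cell j) := by
  rw [cmu, cmu, Measure.prod_smul_left, Measure.prod_smul_right, smul_smul, Measure.prod_restrict,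
    sq01_eq, Measure.restrict_restrict ((cell_meas i).prod (cell_meas j)),
    Set.inter_eq_left.2 (Set.prod_mono (cell_subset i) (cell_subset j))]

lemma sum_cells_le {n : ℕ} {h : ℝ × ℝ → ℝ} (h0 : ∀ q, 0 ≤ h q) (hi : Integrable h sq01) :
    ∑ q : Fin n × Fin n, ∫ z in cell q.1 ×ˢ cell q.2, h z ∂sq01 ≤ ∫ z, h z ∂sq01 := by
  rw [← integral_iUnion_fintype]
  · exact setIntegral_le_integral hi (Eventually.of_forall h0)
  · exact fun q => (cell_meas _).prod (cell_meas _)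
  · intro p q hpq
    refine Set.disjoint_left.2 fun z h1 h2 => hpq ?_
    exact Prod.ext (cell_inj h1.1 h2.1) (cell_inj h1.2 h2.2)
  · exact fun q => hi.integrableOn

lemma choose_points {n : ℕ} {h : ℝ × ℝ → ℝ} (hm : Measurable h) (h0 : ∀ q, 0 ≤ h q) (C : ℝ)
    (hC : ∀ q, |h q| ≤ C) (Q : (Fin n → ℝ) → Prop)
    (hQ : ∀ᵐ x ∂(Measure.pi fun _ : Fin n => mu01), Q x) :
    ∃ x : Fin n → ℝ, Q x ∧ (∀ i, x i ∈ cell i) ∧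
      ∑ q : Fin n × Fin n, (if q.1 ≠ q.2 then h (x q.1, x q.2) else 0)
        ≤ (n : ℝ) ^ 2 * ∫ z, h z ∂sq01 := by
  have hQ' : ∀ᵐ x ∂(Measure.pi fun i : Fin n => cmu i), Q x := (cmu_ac n).ae_le hQ
  have hcell : ∀ᵐ x ∂(Measure.pi fun i : Fin n => cmu i), ∀ i, x i ∈ cell i := by
    rw [ae_all_iff]
    intro i
    have : ∀ᵐ t ∂(cmu i), t ∈ cell i :=
      Measure.smul_absolutelyContinuous.ae_le (ae_restrict_mem (cell_meas i))
    exact (measurePreserving_eval (fun i : Fin n => cmu i) i).quasiMeasurePreserving.ae this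
  have hN := hQ'.and hcell
  have hI : Integrable h sq01 := integrable_of_bdd hm C hC
  have hint : ∀ q : Fin n × Fin n, Integrable (fun x : Fin n → ℝ =>
      if q.1 ≠ q.2 then h (x q.1, x q.2) else 0) (Measure.pi fun i : Fin n => cmu i) := by
    intro q
    by_cases hq : q.1 ≠ q.2
    · simp only [hq, if_true, ne_eq, not_false_eq_true]
      exact integrable_of_bdd (hm.comp (f := fun x : Fin n → ℝ => (x q.1, x q.2)) (by fun_prop)) C
        fun x => hC _
    · simp only [hq, if_false]
      exact integrable_zero _ _ _
  obtain ⟨x, hx, hle⟩ := exists_notMem_null_le_integral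
    (integrable_finsetSum Finset.univ fun q _ => hint q) (ae_iff.1 hN)
  have hx' : Q x ∧ ∀ i, x i ∈ cell i := by
    by_contra hcon
    exact hx hcon
  refine ⟨x, hx'.1, hx'.2, hle.trans ?_⟩
  rw [integral_finsetSum _ fun q _ => hint q]
  refine le_trans ?_ (mul_le_mul_of_nonneg_left (sum_cells_le (n := n) h0 hI) (by positivity))
  rw [Finset.mul_sum]
  refine Finset.sum_le_sum fun q _ => ?_
  by_cases hq : q.1 ≠ q.2
  · simp only [hq, if_true, ne_eq, not_false_eq_true]
    have hmp := mp_pair (fun i : Fin n => cmu i) hq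
    have e1 := integral_map (μ := Measure.pi fun i : Fin n => cmu i) hmp.measurable.aemeasurable
      (f := h) hm.aestronglyMeasurable
    rw [hmp.map_eq, cmu_prod, integral_smul_measure] at e1
    rw [← e1]
    simp [sq]
  · simp only [hq, if_false]
    simp only [integral_zero]
    exact mul_nonneg (by positivity) (integral_nonneg fun z => h0 z)

/-- Indicator function of a cell. -/
def chi {n : ℕ} (i : Fin n) (s : ℝ) : ℝ := (cell i).indicator 1 s

lemma chi_meas {n : ℕ} (i : Fin n) : Measurable (chi i) := measurable_one.indicator (cell_meas i)

lemma chi_mem {n : ℕ} (i : Fin n) (s : ℝ) : 0 ≤ chi i s ∧ chi i s ≤ 1 :=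
  ⟨Set.indicator_nonneg (fun _ _ => zero_le_one) _,
    Set.indicator_le_self' (fun _ _ => zero_le_one) _⟩

lemma chi_sum {n : ℕ} (B : Fin n × Fin n → ℝ) {i j : Fin n} {s t : ℝ} (hs : s ∈ cell i)
    (ht : t ∈ cell j) : ∑ q : Fin n × Fin n, B q * (chi q.1 s * chi q.2 t) = B (i, j) := by
  rw [Finset.sum_eq_single (i, j)]
  · simp [chi, hs, ht]
  · intro q _ hq
    by_cases h1 : s ∈ cell q.1
    · by_cases h2 : t ∈ cell q.2
      · exact absurd (Prod.ext (cell_inj h1 hs) (cell_inj h2 ht)) hq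
      · simp [chi, h2]
    · simp [chi, h1]
  · simp

lemma chi_integrable {n : ℕ} (B : Fin n × Fin n → ℝ) (ν : Measure (ℝ × ℝ)) [IsFiniteMeasure ν]
    (q : Fin n × Fin n) : Integrable (fun z : ℝ × ℝ => B q * (chi q.1 z.1 * chi q.2 z.2)) ν := by
  refine Integrable.const_mul (integrable_of_bdd (((chi_meas q.1).comp measurable_fst).mul
    ((chi_meas q.2).comp measurable_snd)) 1 fun z => ?_) _
  have h1 := chi_mem q.1 z.1
  have h2 := chi_mem q.2 z.2
  change |chi q.1 z.1 * chi q.2 z.2| ≤ 1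
  rw [abs_of_nonneg (mul_nonneg h1.1 h2.1)]
  exact mul_le_one₀ h1.2 h2.1 h2.2

lemma chi_integral {n : ℕ} (B : Fin n × Fin n → ℝ) (μ ν : Measure ℝ) [IsFiniteMeasure μ]
    [IsFiniteMeasure ν] :
    ∫ z, ∑ q : Fin n × Fin n, B q * (chi q.1 z.1 * chi q.2 z.2) ∂(μ.prod ν)
      = ∑ q : Fin n × Fin n, B q * (μ.real (cell q.1) * ν.real (cell q.2)) := by
  rw [integral_finsetSum _ fun q _ => chi_integrable B _ q]
  refine Finset.sum_congr rfl fun q _ => ?_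
  rw [integral_const_mul, integral_prod_mul]
  simp only [chi]
  rw [integral_indicator_one (cell_meas _), integral_indicator_one (cell_meas _)]

lemma cell_real {n : ℕ} (i : Fin n) : mu01.real (cell i) = 1 / n := by
  rw [measureReal_def, mu01, Measure.restrict_apply (cell_meas i),
    Set.inter_eq_left.2 (cell_subset i), cell_volume, ENNReal.toReal_ofReal (by positivity)]

lemma cell_real_le {n : ℕ} (i : Fin n) (S : Set ℝ) : (volume.restrict S).real (cell i) ≤ 1 / n := by
  rw [measureReal_def]
  refine ENNReal.toReal_le_of_le_ofReal (by positivity) ?_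
  rw [← cell_volume i]
  exact Measure.restrict_apply_le _ _

open Classical in
lemma pick_graph (P : GraphProp) {W : ℝ → ℝ → ℝ} (hW : IsGraphon W)
    (hz : ∀ (k : ℕ) (F : SimpleGraph (Fin k)), F ∉ P k → indDensity F W = 0)
    (n : ℕ) {h : ℝ × ℝ → ℝ} (hm : Measurable h) (h0 : ∀ q, 0 ≤ h q) (C : ℝ)
    (hC : ∀ q, |h q| ≤ C) :
    ∃ (G : SimpleGraph (Fin n)) (x : Fin n → ℝ) (A : Fin n → Fin n → ℝ), G ∈ P n ∧
      (∀ i, x i ∈ cell i) ∧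
      ∑ q : Fin n × Fin n, (if q.1 ≠ q.2 then h (x q.1, x q.2) else 0)
        ≤ (n : ℝ) ^ 2 * ∫ z, h z ∂sq01 ∧
      energy A ≤ 2 * (n : ℝ) ^ 3 ∧ (∀ i, A i i = 0) ∧
      ∀ i j, i ≠ j → (if G.Adj i j then (1 : ℝ) else 0) = A i j + W (x i) (x j) := by
  have hQ : ∀ᵐ x ∂(Measure.pi fun _ : Fin n => mu01),
      ∀ G : SimpleGraph (Fin n), G ∉ P n → ∏ p, factor G W p x = 0 := by
    rw [ae_all_iff]
    intro G
    by_cases hG : G ∈ P n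
    · exact Eventually.of_forall fun x hx => absurd hG hx
    have h1 := hz n G hG
    rw [indDensity_eq] at h1
    have hmeas : Measurable (fun x => ∏ p, factor G W p x) :=
      Finset.measurable_prod _ fun p _ => factor_measurable G hW p
    have hnn : ∀ x, 0 ≤ ∏ p, factor G W p x := fun x =>
      Finset.prod_nonneg fun p _ => (factor_mem G hW p x).1
    have hint : Integrable (fun x => ∏ p, factor G W p x)
        (Measure.pi fun _ : Fin n => mu01) := by
      refine integrable_of_bdd hmeas 1 fun x => ?_
      rw [abs_of_nonneg (hnn x)]
      exact Finset.prod_le_one (fun p _ => (factor_mem G hW p x).1)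
        fun p _ => (factor_mem G hW p x).2
    rw [integral_eq_zero_iff_of_nonneg hnn hint] at h1
    filter_upwards [h1] with x hx _ using hx
  obtain ⟨x, hx, hxc, hsum⟩ := choose_points hm h0 C hC _ hQ
  let p : Sym2 (Fin n) → ℝ := Sym2.lift ⟨fun i j => W (x i) (x j), fun i j => hW.2.1 _ _⟩
  have hp : ∀ e, 0 ≤ p e ∧ p e ≤ 1 := by
    intro e
    induction e with
    | h i j => exact hW.2.2 _ _
  obtain ⟨v, hv, hE⟩ := exists_rounding hp
  let G : SimpleGraph (Fin n) :=
    { Adj := fun i j => i ≠ j ∧ v s(i, j) = true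
      symm := ⟨fun i j hij => ⟨hij.1.symm, by rw [Sym2.eq_swap]; exact hij.2⟩⟩
      loopless := ⟨fun i hi => hi.1 rfl⟩ }
  refine ⟨G, x, cmat p v, ?_, hxc, hsum, hE, fun i => by simp [cmat], ?_⟩
  · by_contra hG
    have h1 := hx G hG
    rw [Finset.prod_eq_zero_iff] at h1
    obtain ⟨⟨i, j⟩, -, hij⟩ := h1
    have h2 := hv s(i, j)
    have hpe : p s(i, j) = W (x i) (x j) := rfl
    rw [hpe] at h2
    unfold factor at hij
    by_cases hlt : i < j
    · have hA : G.Adj i j ↔ v s(i, j) = true := ⟨fun h => h.2, fun h => ⟨hlt.ne, h⟩⟩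
      simp only [hlt, if_true, hA] at hij
      unfold bw at h2
      linarith
    · simp [hlt] at hij
  · intro i j hij
    have hpe : p s(i, j) = W (x i) (x j) := rfl
    have hA : G.Adj i j ↔ v s(i, j) = true := ⟨fun h => h.2, fun h => ⟨hij, h⟩⟩
    simp only [cmat, hij, if_false, br, hA, hpe]
    ring

lemma ae_sq : ∀ᵐ z ∂sq01, (0 < z.1 ∧ z.1 ≤ 1) ∧ (0 < z.2 ∧ z.2 ≤ 1) := by
  have h : ∀ᵐ t ∂mu01, 0 < t ∧ t ≤ 1 := by
    have h1 : ∀ᵐ t ∂mu01, t ∈ I01 := ae_restrict_mem measurableSet_Icc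
    have h2 : ∀ᵐ t ∂mu01, t ≠ 0 := ae_restrict_of_ae (Measure.ae_ne volume 0)
    filter_upwards [h1, h2] with t h1 h2 using ⟨lt_of_le_of_ne h1.1 h2.symm, h1.2⟩
  have h1 := (Measure.quasiMeasurePreserving_fst (μ := mu01) (ν := mu01)).ae h
  have h2 := (Measure.quasiMeasurePreserving_snd (μ := mu01) (ν := mu01)).ae h
  filter_upwards [h1, h2] with z a b using ⟨a, b⟩

lemma cut_bound {W : ℝ → ℝ → ℝ} (hW : IsGraphon W) {n : ℕ} (hn : 0 < n) {ε : ℝ} (hε : 0 < ε)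
    (hn1 : 1 / (n : ℝ) ≤ ε) (hn4 : 2 / (n : ℝ) ≤ ε ^ 4)
    {V : ℝ × ℝ → ℝ} (hVm : Measurable V) (C : ℝ)
    (hC : ∀ q : ℝ × ℝ, |W q.1 q.2 - V q| ≤ C)
    (hVW : ∫ q, |W q.1 q.2 - V q| ∂sq01 ≤ ε)
    (hVc : ∀ (i j : Fin n) (s t s' t' : ℝ), s ∈ cell i → s' ∈ cell i → t ∈ cell j → t' ∈ cell j →
      |V (s, t) - V (s', t')| ≤ ε)
    (G : SimpleGraph (Fin n)) (x : Fin n → ℝ) (A : Fin n → Fin n → ℝ)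
    (hx : ∀ i, x i ∈ cell i)
    (hsum : ∑ q : Fin n × Fin n, (if q.1 ≠ q.2 then |W (x q.1) (x q.2) - V (x q.1, x q.2)| else 0)
        ≤ (n : ℝ) ^ 2 * ε)
    (hE : energy A ≤ 2 * (n : ℝ) ^ 3) (hA0 : ∀ i, A i i = 0)
    (hA : ∀ i j (s t : ℝ), s ∈ cell i → t ∈ cell j → i ≠ j →
      graphonOf G s t = A i j + W (x i) (x j)) :
    cutNorm (fun s t => graphonOf G s t - W s t) ≤ 5 * ε := by
  have hn' : (0 : ℝ) < n := by exact_mod_cast hn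
  have hGg := graphonOf_isGraphon G
  refine csSup_le ⟨_, ∅, ∅, .empty, .empty, by simp, by simp, rfl⟩ ?_
  rintro r ⟨S, T, hS, hT, hSI, hTI, rfl⟩
  have hfin : ∀ S : Set ℝ, S ⊆ I01 → IsFiniteMeasure (volume.restrict S) := fun S hS => by
    refine ⟨?_⟩
    rw [Measure.restrict_apply_univ]
    exact (measure_mono hS).trans_lt (by simp [I01])
  have := hfin S hSI
  have := hfin T hTI
  set ν : Measure (ℝ × ℝ) := (volume.restrict S).prod (volume.restrict T) with hν
  have hνle : ν ≤ sq01 := by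
    rw [hν, sq01_eq, Measure.prod_restrict]
    exact Measure.restrict_mono (Set.prod_mono hSI hTI) le_rfl
  let D : ℝ × ℝ → ℝ := fun z => graphonOf G z.1 z.2 - W z.1 z.2
  have hDm : Measurable D := hGg.1.sub hW.1
  have hDb : ∀ z, |D z| ≤ 1 := fun z => by
    have h1 := hGg.2.2 z.1 z.2
    have h2 := hW.2.2 z.1 z.2
    rw [abs_le]
    constructor <;> simp only [D] <;> linarith [h1.1, h1.2, h2.1, h2.2]
  have hDi : ∀ (μ : Measure (ℝ × ℝ)) [IsFiniteMeasure μ], Integrable D μ := fun μ _ =>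
    integrable_of_bdd hDm 1 hDb
  let Ef : ℝ × ℝ → ℝ := fun z => ∑ q : Fin n × Fin n, A q.1 q.2 * (chi q.1 z.1 * chi q.2 z.2)
  have hEi : ∀ (μ : Measure (ℝ × ℝ)) [IsFiniteMeasure μ], Integrable Ef μ := fun μ _ =>
    integrable_finsetSum _ fun q _ => chi_integrable (fun q => A q.1 q.2) μ q
  have e1 : ∫ s in S, ∫ t in T, (graphonOf G s t - W s t) = ∫ z, D z ∂ν :=
    (integral_prod D (hDi _)).symm
  rw [e1]
  have e2 : ∫ z, D z ∂ν = ∫ z, Ef z ∂ν + ∫ z, (D z - Ef z) ∂ν := by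
    rw [integral_sub (hDi _) (hEi _)]; ring
  rw [e2]
  -- the random part
  have b1 : |∫ z, Ef z ∂ν| ≤ ε := by
    have h1 : ∫ z, Ef z ∂ν = ∑ i, ∑ j, A i j *
        ((volume.restrict S).real (cell i) * (volume.restrict T).real (cell j)) := by
      rw [← Fintype.sum_prod_type']
      exact chi_integral (fun q => A q.1 q.2) _ _
    have h2 := bilinear_energy A (fun i => (volume.restrict S).real (cell i))
      (fun i => (volume.restrict T).real (cell i)) (1 / n) (fun i => measureReal_nonneg)
      (fun i => cell_real_le i S) (fun i => measureReal_nonneg) (fun i => cell_real_le i T)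
    rw [← h1] at h2
    have h3 : (∫ z, Ef z ∂ν) ^ 4 ≤ ε ^ 4 := by
      refine h2.trans (le_trans ?_ hn4)
      calc (n : ℝ) ^ 4 * (1 / n) ^ 8 * energy A
          ≤ (n : ℝ) ^ 4 * (1 / n) ^ 8 * (2 * (n : ℝ) ^ 3) := by gcongr
        _ = 2 / (n : ℝ) := by field_simp
    refine le_of_pow_le_pow_left₀ (n := 4) (by norm_num) hε.le ?_
    rwa [Even.pow_abs (by decide : Even 4)]
  -- the deterministic part
  let B : Fin n × Fin n → ℝ := fun q =>
    (if q.1 ≠ q.2 then |W (x q.1) (x q.2) - V (x q.1, x q.2)| else 0) + ε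
      + (if q.1 = q.2 then 1 else 0)
  let h : ℝ × ℝ → ℝ := fun q => |W q.1 q.2 - V q|
  have hhm : Measurable h := (hW.1.sub hVm).abs
  have hhi : Integrable h sq01 := integrable_of_bdd hhm C fun q => by
    simp only [h, abs_abs]; exact hC q
  let Bf : ℝ × ℝ → ℝ := fun z => ∑ q : Fin n × Fin n, B q * (chi q.1 z.1 * chi q.2 z.2)
  have hBi : Integrable Bf sq01 := integrable_finsetSum _ fun q _ => chi_integrable B sq01 q
  have b2 : |∫ z, (D z - Ef z) ∂ν| ≤ ∫ z, (Bf z + h z) ∂sq01 := by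
    have hRi : Integrable (fun z => |D z - Ef z|) sq01 := ((hDi sq01).sub (hEi sq01)).abs
    calc |∫ z, (D z - Ef z) ∂ν| ≤ ∫ z, |D z - Ef z| ∂ν := abs_integral_le_integral_abs
      _ ≤ ∫ z, |D z - Ef z| ∂sq01 :=
        integral_mono_measure hνle (Eventually.of_forall fun _ => abs_nonneg _) hRi
      _ ≤ _ := by
        refine integral_mono_ae hRi (hBi.add hhi) ?_
        filter_upwards [ae_sq] with z hz
        obtain ⟨i, hi⟩ := cell_cover hn hz.1.1 hz.1.2
        obtain ⟨j, hj⟩ := cell_cover hn hz.2.1 hz.2.2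
        have e3 : Ef z = A i j := chi_sum (fun q => A q.1 q.2) hi hj
        have e4 : Bf z = B (i, j) := chi_sum B hi hj
        change |D z - Ef z| ≤ Bf z + h z
        rw [e3, e4]
        have hh0 : 0 ≤ h z := abs_nonneg _
        by_cases hij : i = j
        · subst hij
          rw [hA0, sub_zero]
          simp only [B, ne_eq, not_true, if_false, if_true]
          linarith [hDb z]
        · have h5 := hA i j z.1 z.2 hi hj hij
          have h6 := hVc i j (x i) (x j) z.1 z.2 (hx i) hi (hx j) hj
          simp only [B, ne_eq, hij, not_false_eq_true, if_false, if_true, D, h, h5]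
          have e7 : A i j + W (x i) (x j) - W z.1 z.2 - A i j
              = (W (x i) (x j) - V (x i, x j)) + (V (x i, x j) - V (z.1, z.2))
                - (W z.1 z.2 - V z) := by ring
          rw [e7]
          refine (abs_sub _ _).trans ?_
          have := abs_add_le (W (x i) (x j) - V (x i, x j)) (V (x i, x j) - V (z.1, z.2))
          linarith
  have b3 : ∫ z, (Bf z + h z) ∂sq01 ≤ 4 * ε := by
    rw [integral_add hBi hhi]
    have e5 : ∫ z, Bf z ∂sq01 = (∑ q, B q) * (1 / n * (1 / n)) := by
      rw [Finset.sum_mul]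
      refine (chi_integral B mu01 mu01).trans ?_
      simp only [cell_real]
    have e6 : ∑ q, B q ≤ (n : ℝ) ^ 2 * ε + (n : ℝ) ^ 2 * ε + n := by
      simp only [B, Finset.sum_add_distrib]
      refine add_le_add (add_le_add hsum ?_) ?_
      · simp [sq]
      · rw [Fintype.sum_prod_type]; simp
    have e7 : ∫ z, Bf z ∂sq01 ≤ ε + ε + 1 / n := by
      rw [e5]
      calc _ ≤ ((n : ℝ) ^ 2 * ε + (n : ℝ) ^ 2 * ε + n) * (1 / n * (1 / n)) := by gcongr
        _ = _ := by field_simp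
    linarith
  refine (abs_add_le _ _).trans ?_
  linarith

lemma approx (P : GraphProp) {W : ℝ → ℝ → ℝ} (hW : IsGraphon W)
    (hz : ∀ (k : ℕ) (F : SimpleGraph (Fin k)), F ∉ P k → indDensity F W = 0)
    {ε : ℝ} (hε : 0 < ε) :
    ∃ N : ℕ, ∀ n, N ≤ n → ∃ G : SimpleGraph (Fin n), G ∈ P n ∧
      cutNorm (fun s t => graphonOf G s t - W s t) ≤ 5 * ε := by
  have hWi : Integrable (Function.uncurry W) sq01 := integrable_of_bdd hW.1 1 fun z => by
    have := hW.2.2 z.1 z.2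
    change |W z.1 z.2| ≤ 1
    rw [abs_of_nonneg this.1]; exact this.2
  obtain ⟨V, hVs, hV, hVc, -⟩ := hWi.exists_hasCompactSupport_integral_sub_le hε
  have hu := hVs.uniformContinuous_of_continuous hVc
  obtain ⟨C, hC⟩ := hVs.exists_bound_of_continuous hVc
  obtain ⟨η, hη, hη'⟩ := Metric.uniformContinuous_iff.1 hu ε hε
  have hC' : ∀ q : ℝ × ℝ, |W q.1 q.2 - V q| ≤ 1 + C := fun q => by
    have h1 := hW.2.2 q.1 q.2
    have h2 := hC q
    rw [Real.norm_eq_abs] at h2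
    refine (abs_sub _ _).trans (add_le_add ?_ h2)
    rw [abs_of_nonneg h1.1]; exact h1.2
  have hlim : Tendsto (fun n : ℕ => 2 / (n : ℝ)) atTop (𝓝 0) :=
    tendsto_const_div_atTop_nhds_zero_nat 2
  have hlim1 : Tendsto (fun n : ℕ => 1 / (n : ℝ)) atTop (𝓝 0) :=
    tendsto_const_div_atTop_nhds_zero_nat 1
  have hev : ∀ᶠ n : ℕ in atTop, 2 / (n : ℝ) < ε ^ 4 ∧ 1 / (n : ℝ) < ε ∧ 1 / (n : ℝ) < η ∧ 0 < n :=
    (hlim.eventually_lt_const (by positivity)).and ((hlim1.eventually_lt_const hε).and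
      ((hlim1.eventually_lt_const hη).and (eventually_gt_atTop 0)))
  obtain ⟨N, hN⟩ := eventually_atTop.1 hev
  refine ⟨N, fun n hn => ?_⟩
  obtain ⟨h4, h1, hηn, hn0⟩ := hN n hn
  have hVW : ∫ q, |W q.1 q.2 - V q| ∂sq01 ≤ ε := hV
  obtain ⟨G, x, A, hG, hx, hsum, hE, hA0, hA⟩ := pick_graph P hW hz n
    (h := fun q => |W q.1 q.2 - V q|) (hW.1.sub hVc.measurable).abs (fun _ => abs_nonneg _)
    (1 + C) (fun q => by rw [abs_abs]; exact hC' q)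
  refine ⟨G, hG, cut_bound hW hn0 hε h1.le h4.le hVc.measurable (1 + C) hC' hVW ?_ G x A hx
    (hsum.trans ?_) hE hA0 ?_⟩
  · intro i j s t s' t' hs hs' ht ht'
    have := hη' (a := (s, t)) (b := (s', t')) (by
      rw [Prod.dist_eq, max_lt_iff, Real.dist_eq, Real.dist_eq]
      exact ⟨(cell_dist hs hs').trans_lt hηn, (cell_dist ht ht').trans_lt hηn⟩)
    rw [Real.dist_eq] at this
    exact this.le
  · exact mul_le_mul_of_nonneg_left hVW (by positivity)
  · intro i j s t hs ht hij
    rw [graphonOf_apply G hs ht]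
    exact hA i j hij

lemma dir2 (P : GraphProp) {W : ℝ → ℝ → ℝ} (hW : IsGraphon W)
    (hz : ∀ (k : ℕ) (F : SimpleGraph (Fin k)), F ∉ P k → indDensity F W = 0) :
    W ∈ closureP P := by
  have h : ∀ m : ℕ, ∃ n, m ≤ n ∧ ∃ G : SimpleGraph (Fin n), G ∈ P n ∧
      cutNorm (fun s t => graphonOf G s t - W s t) ≤ 1 / ((m : ℝ) + 1) := by
    intro m
    obtain ⟨N, hN⟩ := approx P hW hz (ε := 1 / ((m : ℝ) + 1) / 5) (by positivity)
    obtain ⟨G, hG, hc⟩ := hN (max N m) (le_max_left _ _)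
    exact ⟨_, le_max_right _ _, G, hG, hc.trans_eq (by ring)⟩
  choose n hn G hG hc using h
  refine ⟨hW, n, G, hG, tendsto_atTop_mono hn tendsto_id, ?_⟩
  have hc0 : ∀ U : ℝ → ℝ → ℝ, 0 ≤ cutNorm U := fun U => Real.sSup_nonneg (by
    rintro r ⟨S, T, -, -, -, -, rfl⟩
    exact abs_nonneg _)
  refine squeeze_zero (fun m => Real.iInf_nonneg fun φ => hc0 _) (fun m => ?_)
    tendsto_one_div_add_atTop_nhds_zero_nat
  refine (ciInf_le ⟨0, ?_⟩ idMP).trans (hc m)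
  rintro r ⟨φ, rfl⟩
  exact hc0 _

theorem closure_of_hereditary
    (P : GraphProp) (hP : IsGraphProperty P) (hher : Hereditary P) :
    closureP P =
      {W | IsGraphon W ∧
        ∀ (k : ℕ) (F : SimpleGraph (Fin k)), F ∉ P k → indDensity F W = 0} := by
  ext W
  exact ⟨fun hW => ⟨hW.1, dir1 P hher W hW⟩, fun hW => dir2 P hW.1 hW.2⟩

end
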